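/- arXiv:2210.12434 — 3 statements merged into one kernel-verified Lean document; each statement's English description precedes it below -/
import Mathlib

section
/- Let φ : ℝ → ℝ² be ℤ-periodic Lipschitz with constant L and image φ̂ separating B(0,ε) from ∞. Let c₀ > 1 be the unique solution of c₀ = (L/ε)(2 + 1/(c₀−1)). Let b ≥ 2 be an integer and λ ∈ (1/b, 1) with bλ³ > c₀. Then for every integer n ≥ 1 and k ∈ {0,…,b^n−1}: W(k/b^n) − (λ^n/(1−λ))φ(0) + λ^n(φ̂ + B(0, ελ)) ⊆ { W(s) : s ∈ [k/b^n, (k+1)/b^n] }, where W(x) = Σ_{m≥0} λ^m φ(b^m x). -/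
open scoped Pointwise

local notation "E2" => EuclideanSpace ℝ (Fin 2)

theorem ray_aux (A : Set E2) (hbd : Bornology.IsBounded (connectedComponentIn Aᶜ 0))
    (σ : ℝ) (hσ : σ = 1 ∨ σ = -1) (p : E2) (hp : p ∈ connectedComponentIn Aᶜ 0) :
    ∃ q ∈ A, σ * p 0 ≤ σ * q 0 := by
  by_contra! hcon
  have hconv : Convex ℝ {q : E2 | σ * p 0 ≤ σ * q 0} := by
    intro x hx y hy a c ha hc hac
    simp only [Set.mem_setOf_eq, PiLp.add_apply, PiLp.smul_apply, smul_eq_mul] at *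
    have h1 := mul_le_mul_of_nonneg_left hx ha
    have h2 := mul_le_mul_of_nonneg_left hy hc
    have h3 : σ * p 0 = a * (σ * p 0) + c * (σ * p 0) := by rw [← add_mul, hac, one_mul]
    linarith
  have hsub : {q : E2 | σ * p 0 ≤ σ * q 0} ⊆ Aᶜ := by
    intro q hq hqA
    exact absurd (hcon q hqA) (not_lt.mpr hq)
  have hsub2 := hconv.isPreconnected.subset_connectedComponentIn
    (show p ∈ {q : E2 | σ * p 0 ≤ σ * q 0} by simp) hsub
  rw [← connectedComponentIn_eq hp] at hsub2
  obtain ⟨C, hC⟩ := hbd.exists_norm_le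
  have hm : EuclideanSpace.single (0 : Fin 2) (σ * (|σ * p 0| + |C| + 1)) ∈
      connectedComponentIn Aᶜ (0 : E2) := by
    apply hsub2
    have hs : σ * σ = 1 := by rcases hσ with h | h <;> rw [h] <;> norm_num
    simp only [Set.mem_setOf_eq, EuclideanSpace.single_apply, if_true]
    rw [← mul_assoc, hs, one_mul]
    linarith [le_abs_self (σ * p 0), abs_nonneg C]
  have hn := hC _ hm
  have hs : |σ| = 1 := by rcases hσ with h | h <;> rw [h] <;> norm_num
  rw [EuclideanSpace.norm_single, Real.norm_eq_abs, abs_mul, hs, one_mul,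
    abs_of_nonneg (by positivity)] at hn
  linarith [le_abs_self C, abs_nonneg (σ * p 0)]

theorem fract_aux (φ : ℝ → E2) (hper : ∀ x : ℝ, φ (x + 1) = φ x) (t : ℝ) :
    φ (Int.fract t) = φ t := by
  have h : Function.Periodic φ 1 := hper
  have h2 := h.sub_zsmul_eq (x := t) ⌊t⌋
  rwa [zsmul_one] at h2

theorem cover_aux (φ : ℝ → E2) (ε : ℝ) (hε : 0 < ε)
    (hper : ∀ x : ℝ, φ (x + 1) = φ x) (hcont : Continuous φ)
    (hball : Metric.ball (0 : E2) ε ⊆ (Set.range φ)ᶜ)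
    (hbd : Bornology.IsBounded (connectedComponentIn (Set.range φ)ᶜ 0))
    (lam : ℝ) (hlam0 : 0 < lam) (hlam1 : lam < 1) (y : ℝ) (v : E2) (hv : ‖v‖ < ε * lam) :
    ∃ t s, φ y + v = φ t + lam • φ s := by
  by_contra! hcon
  have hballU : Metric.ball (0 : E2) ε ⊆ connectedComponentIn (Set.range φ)ᶜ 0 :=
    (convex_ball _ _).isPreconnected.subset_connectedComponentIn (Metric.mem_ball_self hε) hball
  let c : ℝ → E2 := fun t => lam⁻¹ • (φ y + v - φ t)
  have hcc : Continuous c := by fun_prop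
  have hcy : c y ∈ connectedComponentIn (Set.range φ)ᶜ 0 := by
    apply hballU
    simp only [c, add_sub_cancel_left, mem_ball_zero_iff, norm_smul, norm_inv, Real.norm_eq_abs,
      abs_of_pos hlam0]
    rw [inv_mul_lt_iff₀ hlam0]; linarith
  have hcA : Set.range c ⊆ (Set.range φ)ᶜ := by
    rintro _ ⟨t, rfl⟩ ⟨s, hs⟩
    apply hcon t s
    rw [hs]
    simp only [c, smul_smul, mul_inv_cancel₀ hlam0.ne', one_smul]
    abel
  have hcU := (isPreconnected_range hcc).subset_connectedComponentIn (Set.mem_range_self y) hcA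
  rw [← connectedComponentIn_eq hcy] at hcU
  have hc0 : Continuous fun t => φ t 0 := by fun_prop
  have hred : ∀ t, φ t = φ (Int.fract t) := fun t =>
    (fract_aux φ hper t).symm
  obtain ⟨t1, -, h1⟩ := isCompact_Icc.exists_isMaxOn (Set.nonempty_Icc.mpr zero_le_one)
    (hc0.continuousOn (s := Set.Icc (0:ℝ) 1))
  obtain ⟨t2, -, h2⟩ := isCompact_Icc.exists_isMinOn (Set.nonempty_Icc.mpr zero_le_one)
    (hc0.continuousOn (s := Set.Icc (0:ℝ) 1))
  have hfr : ∀ t : ℝ, Int.fract t ∈ Set.Icc (0:ℝ) 1 := fun t =>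
    ⟨Int.fract_nonneg t, (Int.fract_lt_one t).le⟩
  have hM : ∀ t, φ t 0 ≤ φ t1 0 := fun t => by rw [hred t]; exact h1 (hfr t)
  have hm : ∀ t, φ t2 0 ≤ φ t 0 := fun t => by rw [hred t]; exact h2 (hfr t)
  have hup : ∀ p ∈ connectedComponentIn (Set.range φ)ᶜ (0 : E2), p 0 ≤ φ t1 0 := by
    intro p hp
    obtain ⟨_, ⟨t, rfl⟩, h⟩ := ray_aux _ hbd 1 (Or.inl rfl) p hp
    linarith [hM t]
  have hlo : ∀ p ∈ connectedComponentIn (Set.range φ)ᶜ (0 : E2), φ t2 0 ≤ p 0 := by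
    intro p hp
    obtain ⟨_, ⟨t, rfl⟩, h⟩ := ray_aux _ hbd (-1) (Or.inr rfl) p hp
    linarith [hm t]
  have hpos : ε / 2 ≤ φ t1 0 := by
    have := hup (EuclideanSpace.single 0 (ε / 2)) (hballU (by
      rw [mem_ball_zero_iff, EuclideanSpace.norm_single, Real.norm_eq_abs,
        abs_of_pos (by positivity)]; linarith))
    simpa using this
  have hneg : φ t2 0 ≤ 0 := by
    simpa using hlo 0 (hballU (Metric.mem_ball_self hε))
  have ha := hup _ (hcU (Set.mem_range_self t2))
  have hb := hlo _ (hcU (Set.mem_range_self t1))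
  simp only [c, PiLp.smul_apply, PiLp.sub_apply, smul_eq_mul] at ha hb
  rw [inv_mul_le_iff₀ hlam0] at ha
  rw [le_inv_mul_iff₀ hlam0] at hb
  nlinarith

theorem step_aux (φ : ℝ → E2) (L ε : ℝ) (hε : 0 < ε)
    (hper : ∀ x : ℝ, φ (x + 1) = φ x)
    (hLip : ∀ x y : ℝ, ‖φ x - φ y‖ ≤ L * |x - y|) (hcont : Continuous φ)
    (hball : Metric.ball (0 : E2) ε ⊆ (Set.range φ)ᶜ)
    (hbd : Bornology.IsBounded (connectedComponentIn (Set.range φ)ᶜ 0))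
    (b : ℕ) (hb : 2 ≤ b) (lam : ℝ) (hlam0 : 0 < lam) (hlam1 : lam < 1) (hL : 0 < L)
    (hr : 1 < lam * b) (herr : L / b + L / (lam * b - 1) < ε * lam ^ 2)
    (n k : ℕ) (y : ℝ) (v : E2) (hv : ‖v‖ < ε * lam) :
    ∃ j : ℕ, j < b ∧ ∃ s : ℝ, ∃ w : E2, ‖w‖ < ε * lam ∧
      (∑ m ∈ Finset.range n, lam ^ m • φ ((b : ℝ) ^ m * ((k : ℝ) / (b : ℝ) ^ n)))
        + lam ^ n • (φ y + v) =
      (∑ m ∈ Finset.range (n + 1),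
        lam ^ m • φ ((b : ℝ) ^ m * (((b * k + j : ℕ) : ℝ) / (b : ℝ) ^ (n + 1))))
        + lam ^ (n + 1) • (φ s + w) := by
  obtain ⟨t, s, hts⟩ := cover_aux φ ε hε hper hcont hball hbd lam hlam0 hlam1 y v hv
  have hbpos : (0 : ℝ) < b := by positivity
  have hφper : Function.Periodic φ 1 := hper
  rw [← fract_aux φ hper t] at hts
  set τ := Int.fract t with hτ
  have hτ0 : 0 ≤ τ := Int.fract_nonneg t
  have hτ1 : τ < 1 := Int.fract_lt_one t
  set j := ⌊(b : ℝ) * τ⌋₊ with hj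
  have hj1 : (j : ℝ) ≤ b * τ := Nat.floor_le (by positivity)
  have hj2 : (b : ℝ) * τ < j + 1 := Nat.lt_floor_add_one _
  have hjb : j < b := by
    have : (j : ℝ) < b := by nlinarith
    exact_mod_cast this
  have hjb' : (j : ℝ) ≤ b := by exact_mod_cast hjb.le
  have hd1 : ‖φ τ - φ (j / b)‖ ≤ L / b := by
    refine (hLip _ _).trans ?_
    have : |τ - j / b| ≤ 1 / b := by
      rw [abs_of_nonneg]
      · rw [sub_le_iff_le_add, ← add_div, le_div_iff₀ hbpos]; linarith
      · rw [sub_nonneg, div_le_iff₀ hbpos]; linarith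
    calc L * |τ - j / b| ≤ L * (1 / b) := by gcongr
      _ = L / b := by ring
  set x₀ : ℝ := (k : ℝ) / (b : ℝ) ^ n with hx₀
  set x₁ : ℝ := ((b * k + j : ℕ) : ℝ) / (b : ℝ) ^ (n + 1) with hx₁
  have hx : x₁ = x₀ + j / b / (b : ℝ) ^ n := by
    rw [hx₁, hx₀]; push_cast; field_simp; ring
  set D : E2 := (∑ m ∈ Finset.range n, lam ^ m • φ ((b : ℝ) ^ m * x₁)) -
    ∑ m ∈ Finset.range n, lam ^ m • φ ((b : ℝ) ^ m * x₀) with hD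
  have hDn : ‖D‖ ≤ lam ^ n * (L / (lam * b - 1)) := by
    have hterm : ∀ m ∈ Finset.range n,
        ‖lam ^ m • φ ((b : ℝ) ^ m * x₁) - lam ^ m • φ ((b : ℝ) ^ m * x₀)‖ ≤
          (lam * b) ^ m * (L / (b : ℝ) ^ n) := by
      intro m _
      rw [← smul_sub, norm_smul, Real.norm_eq_abs, abs_of_pos (by positivity)]
      have h1 : |(b : ℝ) ^ m * x₁ - (b : ℝ) ^ m * x₀| ≤ (b : ℝ) ^ m * (1 / (b : ℝ) ^ n) := by
        rw [← mul_sub, hx, add_sub_cancel_left, abs_of_nonneg (by positivity)]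
        gcongr
        rw [div_le_one hbpos]; exact hjb'
      calc lam ^ m * ‖φ ((b : ℝ) ^ m * x₁) - φ ((b : ℝ) ^ m * x₀)‖
          ≤ lam ^ m * (L * ((b : ℝ) ^ m * (1 / (b : ℝ) ^ n))) := by
            gcongr
            exact (hLip _ _).trans (by gcongr)
        _ = _ := by rw [mul_pow]; ring
    rw [hD, ← Finset.sum_sub_distrib]
    refine (norm_sum_le_of_le _ hterm).trans ?_
    rw [← Finset.sum_mul, geom_sum_eq hr.ne']
    have hr' : 0 < lam * b - 1 := by linarith
    calc ((lam * b) ^ n - 1) / (lam * b - 1) * (L / (b : ℝ) ^ n)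
        ≤ ((lam * b) ^ n) / (lam * b - 1) * (L / (b : ℝ) ^ n) := by
          gcongr; linarith
      _ = _ := by rw [mul_pow]; field_simp
  set R : E2 := (φ τ - φ (j / b)) - (lam ^ n)⁻¹ • D with hR
  have hln : 0 < lam ^ n := by positivity
  have hRn : ‖R‖ < ε * lam ^ 2 := by
    refine lt_of_le_of_lt (norm_sub_le _ _) ?_
    have : ‖(lam ^ n)⁻¹ • D‖ ≤ L / (lam * b - 1) := by
      rw [norm_smul, norm_inv, Real.norm_eq_abs, abs_of_pos hln, inv_mul_le_iff₀ hln]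
      exact hDn
    linarith
  refine ⟨j, hjb, s, lam⁻¹ • R, ?_, ?_⟩
  · rw [norm_smul, norm_inv, Real.norm_eq_abs, abs_of_pos hlam0, inv_mul_lt_iff₀ hlam0]
    linarith [hRn, show ε * lam ^ 2 = lam * (ε * lam) by ring]
  · have hlast : φ ((b : ℝ) ^ n * x₁) = φ (j / b) := by
      have : (b : ℝ) ^ n * x₁ = j / b + k * 1 := by
        rw [hx, hx₀]; field_simp; ring
      rw [this]
      exact (hφper.nat_mul k) _
    rw [← hx₁, Finset.sum_range_succ, hlast, hts]
    have hDD : (∑ m ∈ Finset.range n, lam ^ m • φ ((b : ℝ) ^ m * x₁)) =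
      D + ∑ m ∈ Finset.range n, lam ^ m • φ ((b : ℝ) ^ m * x₀) := by rw [hD]; abel
    have hRR : lam ^ (n + 1) • (φ s + lam⁻¹ • R) =
        lam ^ n • (lam • φ s) + lam ^ n • (φ τ - φ (j / b)) - D := by
      have e1 : lam ^ (n + 1) * lam⁻¹ = lam ^ n := by field_simp; ring
      rw [smul_add, smul_smul, smul_smul, e1, hR, smul_sub, smul_smul, mul_inv_cancel₀ hln.ne',
        one_smul, pow_succ]
      abel
    rw [hDD, hRR, smul_add, smul_sub]
    abel

/-- Under the separation condition, with `c₀ > 1` solving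
`c₀ = (L/ε)(2 + 1/(c₀−1))`, `b ≥ 2`, `λ ∈ (1/b,1)` and `bλ³ > c₀`, one has for all
`n ≥ 1` and `0 ≤ k < b^n`:
`W(k/b^n) − (λ^n/(1−λ))φ(0) + λ^n(φ̂ + B(0,ελ)) ⊆ {W(s) : s ∈ [k/b^n,(k+1)/b^n]}`. -/
theorem stmt6 (φ : ℝ → EuclideanSpace ℝ (Fin 2)) (L ε : ℝ) (hε : 0 < ε)
    (hper : ∀ x : ℝ, φ (x + 1) = φ x)
    (hLip : ∀ x y : ℝ, ‖φ x - φ y‖ ≤ L * |x - y|)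
    (hball : Metric.ball (0 : EuclideanSpace ℝ (Fin 2)) ε ⊆ (Set.range φ)ᶜ)
    (hbd : Bornology.IsBounded (connectedComponentIn (Set.range φ)ᶜ 0))
    (c₀ : ℝ) (hc₀1 : 1 < c₀) (hc₀ : c₀ = (L / ε) * (2 + 1 / (c₀ - 1)))
    (b : ℕ) (hb : 2 ≤ b) (lam : ℝ) (hlam0 : 1 / (b : ℝ) < lam) (hlam1 : lam < 1)
    (hcond : (b : ℝ) * lam ^ 3 > c₀)
    (W : ℝ → EuclideanSpace ℝ (Fin 2))
    (hW : ∀ x : ℝ, W x = ∑' m : ℕ, lam ^ m • φ ((b : ℝ) ^ m * x)) :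
    ∀ n : ℕ, 1 ≤ n → ∀ k : ℕ, k < b ^ n →
      ∀ u ∈ Set.range φ + Metric.ball (0 : EuclideanSpace ℝ (Fin 2)) (ε * lam),
        W ((k : ℝ) / (b : ℝ) ^ n) - (lam ^ n / (1 - lam)) • φ 0 + lam ^ n • u ∈
          W '' Set.Icc ((k : ℝ) / (b : ℝ) ^ n) (((k : ℝ) + 1) / (b : ℝ) ^ n) := by
  have hbpos : (0 : ℝ) < b := by positivity
  have hl0 : 0 < lam := lt_trans (by positivity) hlam0
  have hr : 1 < lam * b := by rwa [div_lt_iff₀ hbpos] at hlam0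
  have hc1 : 0 < c₀ - 1 := by linarith
  have hL : 0 < L := by
    by_contra! h
    have : (L / ε) * (2 + 1 / (c₀ - 1)) ≤ 0 :=
      mul_nonpos_of_nonpos_of_nonneg (div_nonpos_of_nonpos_of_nonneg h hε.le) (by positivity)
    linarith
  have hεL : ε = L / c₀ + L / (c₀ - 1) := by
    have hc0 : 0 < c₀ := by linarith
    field_simp at hc₀ ⊢
    linarith
  have hl2 : lam ^ 2 ≤ 1 := pow_le_one₀ hl0.le hlam1.le
  have hl2p : 0 < lam ^ 2 := by positivity
  have herr : L / b + L / (lam * b - 1) < ε * lam ^ 2 := by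
    have hc0 : 0 < c₀ := by linarith
    have h1 : L / b < L / c₀ * lam ^ 2 := by
      rw [div_mul_eq_mul_div, div_lt_div_iff₀ hbpos hc0, mul_assoc]
      have : c₀ < lam ^ 2 * b := by nlinarith [mul_pos hl2p hbpos]
      gcongr
    have h2 : L / (lam * b - 1) ≤ L / (c₀ - 1) * lam ^ 2 := by
      rw [div_mul_eq_mul_div, div_le_div_iff₀ (by linarith) hc1, mul_assoc]
      gcongr
      nlinarith
    rw [hεL, add_mul]
    linarith
  have hcont : Continuous φ := by
    have : LipschitzWith (Real.toNNReal L) φ := LipschitzWith.of_dist_le_mul fun x y => by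
      rw [dist_eq_norm, Real.dist_eq, Real.coe_toNNReal _ hL.le]; exact hLip x y
    exact this.continuous
  have hφper : Function.Periodic φ 1 := hper
  set M : ℝ := ‖φ 0‖ + L with hMdef
  have hM : ∀ x, ‖φ x‖ ≤ M := by
    intro x
    rw [← fract_aux φ hper x]
    have h := hLip (Int.fract x) 0
    have h2 : |Int.fract x - 0| ≤ 1 := by
      rw [sub_zero, abs_of_nonneg (Int.fract_nonneg x)]; exact (Int.fract_lt_one x).le
    have h3 : L * |Int.fract x - 0| ≤ L := by nlinarith
    have h4 := norm_le_norm_add_norm_sub' (φ (Int.fract x)) (φ 0)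
    linarith
  have hgs : Summable fun m : ℕ => lam ^ m * M :=
    (summable_geometric_of_lt_one hl0.le hlam1).mul_right M
  have hbound : ∀ (m : ℕ) (x : ℝ), ‖lam ^ m • φ ((b : ℝ) ^ m * x)‖ ≤ lam ^ m * M := by
    intro m x
    rw [norm_smul, Real.norm_eq_abs, abs_of_pos (by positivity)]
    gcongr
    exact hM _
  have hWc : Continuous W := by
    rw [funext hW]
    exact continuous_tsum (fun m => by fun_prop) hgs hbound
  have hWk : ∀ n k : ℕ, W ((k : ℝ) / (b : ℝ) ^ n) =
      (∑ m ∈ Finset.range n, lam ^ m • φ ((b : ℝ) ^ m * ((k : ℝ) / (b : ℝ) ^ n)))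
        + (lam ^ n / (1 - lam)) • φ 0 := by
    intro n k
    rw [hW, ← (Summable.of_norm_bounded hgs fun m => hbound m _).sum_add_tsum_nat_add n]
    congr 1
    have : ∀ m : ℕ, lam ^ (m + n) • φ ((b : ℝ) ^ (m + n) * ((k : ℝ) / (b : ℝ) ^ n)) =
        (lam ^ m * lam ^ n) • φ 0 := by
      intro m
      have e : (b : ℝ) ^ (m + n) * ((k : ℝ) / (b : ℝ) ^ n) =
          0 + ((b ^ m * k : ℕ) : ℝ) * 1 := by
        rw [pow_add]; push_cast; field_simp; ring
      rw [e, (hφper.nat_mul (b ^ m * k)) 0, pow_add]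
    simp_rw [this]
    rw [((summable_geometric_of_lt_one hl0.le hlam1).mul_right _).tsum_smul_const,
      tsum_mul_right, tsum_geometric_of_lt_one hl0.le hlam1]
    congr 1
    ring
  intro n hn k hk u hu
  rw [hWk, add_sub_cancel_right]
  obtain ⟨_, ⟨y, rfl⟩, v, hv, rfl⟩ := hu
  rw [mem_ball_zero_iff] at hv
  set z := (∑ m ∈ Finset.range n, lam ^ m • φ ((b : ℝ) ^ m * ((k : ℝ) / (b : ℝ) ^ n)))
        + lam ^ n • (φ y + v) with hz
  have hind : ∀ i : ℕ, ∃ K : ℕ, ∃ s : ℝ, ∃ w : EuclideanSpace ℝ (Fin 2), ‖w‖ < ε * lam ∧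
      (k : ℝ) / (b : ℝ) ^ n ≤ (K : ℝ) / (b : ℝ) ^ (n + i) ∧
      ((K : ℝ) + 1) / (b : ℝ) ^ (n + i) ≤ ((k : ℝ) + 1) / (b : ℝ) ^ n ∧
      z = (∑ m ∈ Finset.range (n + i),
        lam ^ m • φ ((b : ℝ) ^ m * ((K : ℝ) / (b : ℝ) ^ (n + i))))
        + lam ^ (n + i) • (φ s + w) := by
    intro i
    induction i with
    | zero => exact ⟨k, y, v, hv, le_rfl, le_rfl, hz⟩
    | succ i ih =>
      obtain ⟨K, s, w, hw, h1, h2, h3⟩ := ih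
      obtain ⟨j, hjb, s', w', hw', h4⟩ := step_aux φ L ε hε hper hLip hcont hball hbd b hb lam hl0
        hlam1 hL hr herr (n + i) K s w hw
      refine ⟨b * K + j, s', w', hw', h1.trans ?_, le_trans ?_ h2, h3.trans h4⟩
      · rw [← add_assoc, div_le_div_iff₀ (by positivity) (by positivity), pow_succ]
        have : (0:ℝ) ≤ j * (b : ℝ) ^ (n + i) := by positivity
        push_cast
        linarith
      · rw [← add_assoc, div_le_div_iff₀ (by positivity) (by positivity), pow_succ]
        have hj : (j : ℝ) + 1 ≤ b := by exact_mod_cast hjb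
        have := mul_le_mul_of_nonneg_right hj (by positivity : (0:ℝ) ≤ (b : ℝ) ^ (n + i))
        push_cast
        linarith
  have hclosed : IsClosed (W '' Set.Icc ((k : ℝ) / (b : ℝ) ^ n) (((k : ℝ) + 1) / (b : ℝ) ^ n)) :=
    (isCompact_Icc.image hWc).isClosed
  rw [← hclosed.closure_eq, Metric.mem_closure_iff]
  intro δ hδ
  set C : ℝ := M + ε * lam + 1 / (1 - lam) * M with hC
  have hlim : Filter.Tendsto (fun i : ℕ => lam ^ i * C) Filter.atTop (nhds 0) := by
    simpa using (tendsto_pow_atTop_nhds_zero_of_lt_one hl0.le hlam1).mul_const C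
  obtain ⟨i, hi⟩ := (hlim.eventually (gt_mem_nhds hδ)).exists
  obtain ⟨K, s, w, hw, h1, h2, h3⟩ := hind i
  refine ⟨_, ⟨(K : ℝ) / (b : ℝ) ^ (n + i), ⟨h1, le_trans ?_ h2⟩, rfl⟩, ?_⟩
  · gcongr; linarith
  · have hM0 : 0 ≤ M := (norm_nonneg _).trans (hM 0)
    have h1l : 0 < 1 - lam := by linarith
    have hC0 : 0 ≤ C := by positivity
    have e : (lam ^ (n + i) / (1 - lam)) • φ 0 =
        lam ^ (n + i) • ((1 / (1 - lam)) • φ 0) := by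
      rw [smul_smul, mul_one_div]
    rw [hWk, dist_eq_norm, h3, add_sub_add_left_eq_sub, e, ← smul_sub, norm_smul,
      Real.norm_eq_abs, abs_of_pos (by positivity)]
    refine lt_of_le_of_lt ?_ hi
    apply mul_le_mul _ _ (norm_nonneg _) (by positivity)
    · exact pow_le_pow_of_le_one hl0.le hlam1.le (by omega)
    · refine (norm_sub_le _ _).trans ?_
      refine add_le_add ((norm_add_le _ _).trans (add_le_add (hM _) hw.le)) ?_
      rw [norm_smul, Real.norm_eq_abs, abs_of_pos (by positivity)]
      gcongr
      exact hM 0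
end

section
/- Let φ : ℝ → ℝ² be ℤ-periodic Lipschitz with constant L and image φ̂ separating B(0,ε) from ∞. Let c₁ > 1 solve c₁ = (L/ε)(4 + 1/(c₁−1)), and set c₂ = max{c₁, 2L/Δ(φ)}. Let b ≥ 2 be an integer, λ ∈ (0,1/2) with bλ² > c₂. For β ∈ [0,1) define ℓ_β(s) = φ(s) + λ^{−1}(φ(β + s/b) − φ(β)). Then for every integer n ≥ 1 and k ∈ {0,…,b^n−1}: W(k/b^n) − (λ^n/(1−λ))φ(0) + λ^n(ℓ̂_{k/b} + B(0, ελ)) ⊆ { W(s) : s ∈ [k/b^n, (k+1)/b^n] }. -/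
open scoped Pointwise

section Aux

variable {E : Type*} [NormedAddCommGroup E] [NormedSpace ℝ E]

/-- Every ray from a bounded complementary component hits `K`. -/
lemma aux_ray (K : Set E) (hbd : Bornology.IsBounded (connectedComponentIn Kᶜ 0))
    (x w : E) (hx : x ∈ connectedComponentIn Kᶜ 0) (hw : w ≠ 0) :
    ∃ r : ℝ, 0 ≤ r ∧ x + r • w ∈ K := by
  by_contra! h
  have hsub : (fun r : ℝ => x + r • w) '' Set.Ici 0 ⊆ connectedComponentIn Kᶜ x := by
    apply IsPreconnected.subset_connectedComponentIn
    · apply IsPreconnected.image isPreconnected_Ici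
      fun_prop
    · exact ⟨0, by simp, by simp⟩
    · rintro _ ⟨r, hr, rfl⟩
      exact h r hr
  rw [← connectedComponentIn_eq hx] at hsub
  obtain ⟨R, hR⟩ := (hbd.subset hsub).exists_norm_le
  have hwp : 0 < ‖w‖ := norm_pos_iff.mpr hw
  have hR0 : ‖x‖ ≤ R := by
    have := hR x ⟨0, by simp, by simp⟩
    exact this
  have hnn := norm_nonneg x
  set r : ℝ := (R + ‖x‖ + 1) / ‖w‖ with hr
  have hrp : 0 ≤ r := div_nonneg (by linarith) hwp.le
  have h1 := hR (x + r • w) ⟨r, hrp, rfl⟩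
  have h2 : ‖r • w‖ = R + ‖x‖ + 1 := by
    rw [norm_smul, Real.norm_of_nonneg hrp, hr]
    field_simp
  have h3 : ‖r • w‖ ≤ ‖x + r • w‖ + ‖x‖ := by
    have := norm_sub_le (x + r • w) x
    simpa using this
  linarith

lemma aux_diam (K : Set E) (hK : Bornology.IsBounded K)
    (hbd : Bornology.IsBounded (connectedComponentIn Kᶜ 0))
    (x y : E) (hx : x ∈ connectedComponentIn Kᶜ 0) (hy : y ∈ connectedComponentIn Kᶜ 0) :
    ‖x - y‖ ≤ Metric.diam K := by
  by_cases hxy : x - y = 0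
  · rw [hxy, norm_zero]; exact Metric.diam_nonneg
  have hyx : y - x ≠ 0 := by
    intro h; apply hxy; rw [← neg_sub, h, neg_zero]
  obtain ⟨r, hr, h1⟩ := aux_ray K hbd x (x - y) hx hxy
  obtain ⟨r', hr', h2⟩ := aux_ray K hbd y (y - x) hy hyx
  have h3 := Metric.dist_le_diam_of_mem hK h1 h2
  rw [dist_eq_norm] at h3
  have h4 : x + r • (x - y) - (y + r' • (y - x)) = (1 + r + r') • (x - y) := by module
  rw [h4, norm_smul, Real.norm_of_nonneg (by positivity)] at h3
  nlinarith [norm_nonneg (x - y), mul_nonneg hr (norm_nonneg (x - y)),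
    mul_nonneg hr' (norm_nonneg (x - y))]

/-- Sweeping argument. -/
lemma aux_sweep (φ : ℝ → E) (L ε : ℝ) (hε : 0 < ε) (hE : ∃ w : E, w ≠ 0)
    (hper : ∀ x : ℝ, φ (x + 1) = φ x)
    (hLip : ∀ x y : ℝ, ‖φ x - φ y‖ ≤ L * |x - y|)
    (hcont : Continuous φ) (hK : Bornology.IsBounded (Set.range φ))
    (hball : Metric.ball (0 : E) ε ⊆ (Set.range φ)ᶜ)
    (hbd : Bornology.IsBounded (connectedComponentIn (Set.range φ)ᶜ 0))
    (b lam : ℝ) (hb : 0 < b) (hlam0 : 0 < lam) (hlam1 : lam < 1 / 2)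
    (hcond : b * lam ^ 2 > 2 * L / Metric.diam (Set.range φ))
    (β s : ℝ) (hs : s ∈ Set.Icc (0 : ℝ) 1) (u : E)
    (hu : ‖u - (φ s + lam⁻¹ • (φ (β + s / b) - φ β))‖ < ε * lam) :
    ∃ s' ∈ Set.Icc (0 : ℝ) 1, ∃ t : ℝ,
      u = (φ s' + lam⁻¹ • (φ (β + s' / b) - φ β)) + lam • φ t := by
  by_contra! h
  set l : ℝ → E := fun s => φ s + lam⁻¹ • (φ (β + s / b) - φ β) with hl
  have hL : 0 ≤ L := by
    have := hLip 1 0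
    simp only [sub_zero, abs_one, mul_one] at this
    exact (norm_nonneg _).trans this
  set C := connectedComponentIn (Set.range φ)ᶜ 0 with hC
  have hballC : Metric.ball (0 : E) ε ⊆ C :=
    (convex_ball 0 ε).isPreconnected.subset_connectedComponentIn (Metric.mem_ball_self hε) hball
  set D := Metric.diam (Set.range φ) with hD
  have hDpos : 0 < D := by
    obtain ⟨w, hw⟩ := hE
    have hwp : 0 < ‖w‖ := norm_pos_iff.mpr hw
    have hn : ‖(ε / 2 / ‖w‖) • w‖ = ε / 2 := by
      rw [norm_smul, Real.norm_of_nonneg (by positivity)]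
      field_simp
    have h1 : (ε / 2 / ‖w‖) • w ∈ C := hballC (by rw [mem_ball_zero_iff, hn]; linarith)
    have h2 := aux_diam _ hK hbd _ 0 h1 (hballC (Metric.mem_ball_self hε))
    rw [sub_zero, hn] at h2
    linarith
  have hlc : Continuous l := by fun_prop
  have hq0 : lam⁻¹ • (u - l s) ∈ C := by
    apply hballC
    rw [mem_ball_zero_iff, norm_smul, norm_inv, Real.norm_of_nonneg hlam0.le]
    rw [inv_mul_lt_iff₀ hlam0]
    linarith
  have hsub : (fun s => lam⁻¹ • (u - l s)) '' Set.Icc 0 1 ⊆ C := by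
    rw [hC, connectedComponentIn_eq hq0]
    apply IsPreconnected.subset_connectedComponentIn
    · apply IsPreconnected.image isPreconnected_Icc
      fun_prop
    · exact ⟨s, hs, rfl⟩
    · rintro _ ⟨s', hs', rfl⟩ ⟨t, ht⟩
      apply h s' hs' t
      rw [ht, smul_smul, mul_inv_cancel₀ hlam0.ne']
      simp [hl]
  have hdl : ∀ x ∈ Set.Icc (0 : ℝ) 1, ∀ y ∈ Set.Icc (0 : ℝ) 1, ‖l x - l y‖ ≤ lam * D := by
    intro x hx y hy
    have := aux_diam _ hK hbd _ _ (hsub ⟨y, hy, rfl⟩) (hsub ⟨x, hx, rfl⟩)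
    have h2 : lam⁻¹ • (u - l y) - lam⁻¹ • (u - l x) = lam⁻¹ • (l x - l y) := by module
    simp only [h2] at this
    rw [norm_smul, norm_inv, Real.norm_of_nonneg hlam0.le, inv_mul_le_iff₀ hlam0] at this
    exact this
  have hcond' : L / (lam * b) < lam * D / 2 := by
    rw [gt_iff_lt, div_lt_iff₀ hDpos] at hcond
    rw [div_lt_iff₀ (by positivity)]
    nlinarith
  have hdφ : ∀ x ∈ Set.Icc (0 : ℝ) 1, ∀ y ∈ Set.Icc (0 : ℝ) 1,
      ‖φ x - φ y‖ ≤ lam * D + L / (lam * b) := by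
    intro x hx y hy
    have h1 : φ x - φ y = (l x - l y) - lam⁻¹ • (φ (β + x / b) - φ (β + y / b)) := by
      simp only [hl]; module
    have h2 : ‖lam⁻¹ • (φ (β + x / b) - φ (β + y / b))‖ ≤ L / (lam * b) := by
      rw [norm_smul, norm_inv, Real.norm_of_nonneg hlam0.le]
      have h3 := hLip (β + x / b) (β + y / b)
      have h4 : |β + x / b - (β + y / b)| ≤ 1 / b := by
        have : β + x / b - (β + y / b) = (x - y) / b := by ring
        rw [this, abs_div, abs_of_pos hb]
        gcongr
        rw [abs_le]; constructor <;> linarith [hx.1, hx.2, hy.1, hy.2]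
      calc lam⁻¹ * ‖φ (β + x / b) - φ (β + y / b)‖ ≤ lam⁻¹ * (L * (1 / b)) := by
            gcongr; exact h3.trans (by gcongr)
        _ = L / (lam * b) := by field_simp
    rw [h1]
    exact (norm_sub_le _ _).trans (add_le_add (hdl x hx y hy) h2)
  have hfin : D ≤ lam * D + L / (lam * b) := by
    apply Metric.diam_le_of_forall_dist_le (by positivity)
    have hp : Function.Periodic φ 1 := hper
    have hfr : ∀ x, φ x = φ (Int.fract x) := by
      intro x
      have := hp.sub_int_mul_eq (x := x) ⌊x⌋
      rw [mul_one] at this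
      exact this.symm
    rintro _ ⟨x, rfl⟩ _ ⟨y, rfl⟩
    rw [dist_eq_norm, hfr x, hfr y]
    exact hdφ _ ⟨Int.fract_nonneg _, (Int.fract_lt_one _).le⟩ _
      ⟨Int.fract_nonneg _, (Int.fract_lt_one _).le⟩
  nlinarith

/-- The numerical inequality. -/
lemma aux_num (L ε c b lam : ℝ) (hε : 0 < ε) (hL : 0 ≤ L) (hc1 : 1 < c)
    (hc : c = (L / ε) * (4 + 1 / (c - 1))) (hb : 0 < b) (hlam0 : 0 < lam) (hlam1 : lam < 1 / 2)
    (hcond : c < b * lam ^ 2) :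
    L / b + L / (lam * b ^ 2) + L / (lam * b * (lam * b - 1)) + L / b < ε * lam ^ 2 := by
  have hL0 : 0 < L := by
    rcases hL.eq_or_lt with h | h
    · rw [← h] at hc; simp at hc; linarith
    · exact h
  have hc' : ε * c = L * (4 + 1 / (c - 1)) := by
    rw [eq_comm, ← sub_eq_zero]
    have : c * ε = (L / ε) * (4 + 1 / (c - 1)) * ε := by rw [← hc]
    field_simp at this ⊢
    linarith
  have hc0 : 0 < c := by linarith
  have hcm : 0 < c - 1 := by linarith
  have h1 : L / b < L * (lam ^ 2 / c) := by
    rw [div_lt_iff₀ hb]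
    have : 1 < lam ^ 2 / c * b := by
      rw [div_mul_eq_mul_div, lt_div_iff₀ hc0]; linarith
    nlinarith
  have hr : c / lam < lam * b := by
    rw [div_lt_iff₀ hlam0]; nlinarith
  have hcl : c < c / lam := by
    rw [lt_div_iff₀ hlam0]; nlinarith
  have h2 : L / (lam * b ^ 2) ≤ L / b := by
    apply div_le_div_of_nonneg_left hL hb
    nlinarith
  have h3 : L / (lam * b * (lam * b - 1)) ≤ L * (lam ^ 2 / c * (1 / (c - 1))) := by
    have e : L * (lam ^ 2 / c * (1 / (c - 1))) = L / ((c / lam) * ((c - 1) / lam)) := by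
      field_simp
    rw [e]
    apply div_le_div_of_nonneg_left hL (by positivity)
    have : (c - 1) / lam ≤ lam * b - 1 := by
      rw [div_le_iff₀ hlam0]
      rw [div_lt_iff₀ hlam0] at hr
      nlinarith
    apply mul_le_mul hr.le this (by positivity) (by positivity)
  have h4 : ε * lam ^ 2 = 4 * (L * (lam ^ 2 / c)) + L * (lam ^ 2 / c * (1 / (c - 1))) := by
    have : ε = L * (4 + 1 / (c - 1)) / c := by rw [← hc']; field_simp
    rw [this]; ring
  have : 0 < L * (lam ^ 2 / c) := by positivity
  linarith

/-- One step of the nested construction. -/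
lemma aux_step (φ : ℝ → E) (L ε : ℝ) (hε : 0 < ε) (hE : ∃ w : E, w ≠ 0)
    (hper : ∀ x : ℝ, φ (x + 1) = φ x)
    (hLip : ∀ x y : ℝ, ‖φ x - φ y‖ ≤ L * |x - y|)
    (hcont : Continuous φ) (hK : Bornology.IsBounded (Set.range φ))
    (hball : Metric.ball (0 : E) ε ⊆ (Set.range φ)ᶜ)
    (hbd : Bornology.IsBounded (connectedComponentIn (Set.range φ)ᶜ 0))
    (c₁ : ℝ) (hc₁1 : 1 < c₁) (hc₁ : c₁ = (L / ε) * (4 + 1 / (c₁ - 1)))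
    (b : ℕ) (hb : 2 ≤ b) (lam : ℝ) (hlam0 : 0 < lam) (hlam1 : lam < 1 / 2)
    (hcond : (b : ℝ) * lam ^ 2 > max c₁ (2 * L / Metric.diam (Set.range φ)))
    (N k : ℕ) (p : E) (s : ℝ) (hs : s ∈ Set.Icc (0 : ℝ) 1)
    (hp : ‖p - ∑ m ∈ Finset.range (N + 1), lam ^ m • φ ((b : ℝ) ^ m * ((k : ℝ) / (b : ℝ) ^ (N + 1)))
      - lam ^ (N + 1) • (φ s + lam⁻¹ • (φ ((k : ℝ) / b + s / b) - φ ((k : ℝ) / b)))‖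
      < lam ^ (N + 1) * (ε * lam)) :
    ∃ i : ℕ, i < b ∧ ∃ t ∈ Set.Icc (0 : ℝ) 1,
     ‖p - ∑ m ∈ Finset.range (N + 2),
          lam ^ m • φ ((b : ℝ) ^ m * (((b * k + i : ℕ) : ℝ) / (b : ℝ) ^ (N + 2)))
      - lam ^ (N + 2) • (φ t + lam⁻¹ • (φ (((b * k + i : ℕ) : ℝ) / b + t / b)
          - φ (((b * k + i : ℕ) : ℝ) / b)))‖
      < lam ^ (N + 2) * (ε * lam) := by
  have hL : 0 ≤ L := by
    have := hLip 1 0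
    simp only [sub_zero, abs_one, mul_one] at this
    exact (norm_nonneg _).trans this
  have hP : Function.Periodic φ 1 := hper
  have hfr : ∀ x, φ x = φ (Int.fract x) := by
    intro x
    have := hP.sub_int_mul_eq (x := x) ⌊x⌋
    rw [mul_one] at this
    exact this.symm
  have hb0 : (0 : ℝ) < b := by positivity
  have hb2 : (2 : ℝ) ≤ b := by exact_mod_cast hb
  set A : E := ∑ m ∈ Finset.range (N + 1), lam ^ m • φ ((b : ℝ) ^ m * ((k : ℝ) / (b : ℝ) ^ (N + 1)))
    with hA
  have hlN : 0 < lam ^ (N + 1) := by positivity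
  set u : E := (lam ^ (N + 1))⁻¹ • (p - A) with hu
  have hpu : p = A + lam ^ (N + 1) • u := by
    rw [hu, smul_smul, mul_inv_cancel₀ hlN.ne']; simp
  have hus : ‖u - (φ s + lam⁻¹ • (φ ((k : ℝ) / b + s / b) - φ ((k : ℝ) / b)))‖ < ε * lam := by
    have e : p - A - lam ^ (N + 1) • (φ s + lam⁻¹ • (φ ((k : ℝ) / b + s / b) - φ ((k : ℝ) / b)))
      = lam ^ (N + 1) • (u - (φ s + lam⁻¹ • (φ ((k : ℝ) / b + s / b) - φ ((k : ℝ) / b)))) := by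
      rw [hpu]; module
    rw [e, norm_smul, Real.norm_of_nonneg hlN.le] at hp
    exact lt_of_mul_lt_mul_left hp hlN.le
  obtain ⟨s', hs', t, ht⟩ := aux_sweep φ L ε hε hE hper hLip hcont hK hball hbd b lam hb0 hlam0 hlam1
    (lt_of_le_of_lt (le_max_right _ _) hcond) _ s hs u hus
  rw [hfr t] at ht
  set t' := Int.fract t with ht'
  have ht0 : 0 ≤ t' := Int.fract_nonneg _
  have ht1 : t' ≤ 1 := (Int.fract_lt_one _).le
  -- choose the digit
  obtain ⟨i, hib, hi1, hi2⟩ : ∃ i : ℕ, i < b ∧ (i : ℝ) / b ≤ s' ∧ s' ≤ (i + 1) / b := by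
    rcases hs'.2.lt_or_eq with h | h
    · refine ⟨⌊s' * b⌋₊, ?_, ?_, ?_⟩
      · rw [Nat.floor_lt (mul_nonneg hs'.1 hb0.le)]
        nlinarith
      · rw [div_le_iff₀ hb0]
        exact Nat.floor_le (mul_nonneg hs'.1 hb0.le)
      · rw [le_div_iff₀ hb0]
        exact (Nat.lt_floor_add_one _).le
    · refine ⟨b - 1, by omega, ?_, ?_⟩
      · rw [h, div_le_iff₀ hb0, Nat.cast_sub (by omega)]; simp
      · rw [h, le_div_iff₀ hb0, Nat.cast_sub (by omega)]; simp
  refine ⟨i, hib, t', ⟨ht0, ht1⟩, ?_⟩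
  have hib' : (i : ℝ) ≤ b := by exact_mod_cast hib.le
  have hi_div : (i : ℝ) / b ≤ 1 := by rw [div_le_one hb0]; exact hib'
  have hi_nn : 0 ≤ (i : ℝ) / b := by positivity
  have hx' : ((b * k + i : ℕ) : ℝ) / (b : ℝ) = k + i / b := by
    push_cast; field_simp
  have hkper : ∀ x : ℝ, φ ((k : ℝ) + x) = φ x := by
    intro x
    have := hP.nat_mul k x
    rw [mul_one] at this
    rw [add_comm, this]
  rw [hx', add_assoc, hkper, hkper]
  -- split the new sum
  rw [Finset.sum_range_succ, Finset.sum_range_succ]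
  have e1 : (b : ℝ) ^ (N + 1) * (((b * k + i : ℕ) : ℝ) / (b : ℝ) ^ (N + 2)) = k + i / b := by
    rw [← hx']; field_simp; ring
  have e2 : (b : ℝ) ^ N * (((b * k + i : ℕ) : ℝ) / (b : ℝ) ^ (N + 2)) = k / b + (i / b) / b := by
    rw [← add_div, ← hx']; field_simp; ring
  have e3 : (b : ℝ) ^ N * ((k : ℝ) / (b : ℝ) ^ (N + 1)) = k / b := by
    field_simp; ring
  rw [e1, e2, hkper]
  set S' : E := ∑ m ∈ Finset.range N,
    lam ^ m • φ ((b : ℝ) ^ m * (((b * k + i : ℕ) : ℝ) / (b : ℝ) ^ (N + 2))) with hS'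
  set S : E := ∑ m ∈ Finset.range N, lam ^ m • φ ((b : ℝ) ^ m * ((k : ℝ) / (b : ℝ) ^ (N + 1)))
    with hS
  have hAS : A = S + lam ^ N • φ ((k : ℝ) / b) := by
    rw [hA, Finset.sum_range_succ, e3]
  -- slow terms
  have hr1 : 1 < lam * b := by
    have h := lt_of_le_of_lt (le_max_left _ _) hcond
    have h0 : lam * b * lam < lam * b := by
      nlinarith [mul_pos hlam0 hb0]
    nlinarith
  have hslow : ‖S - S'‖ ≤ lam ^ (N + 1) * (L / (lam * b * (lam * b - 1))) := by
    have h1 : ‖S - S'‖ ≤ ∑ m ∈ Finset.range N, (lam * b) ^ m * (L / (b : ℝ) ^ (N + 1)) := by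
      rw [hS, hS', ← Finset.sum_sub_distrib]
      refine norm_sum_le_of_le _ fun m _ => ?_
      rw [← smul_sub, norm_smul, Real.norm_of_nonneg (by positivity), mul_pow, mul_assoc]
      gcongr
      refine (hLip _ _).trans ?_
      have e4 : (b : ℝ) ^ m * ((k : ℝ) / (b : ℝ) ^ (N + 1)) -
          (b : ℝ) ^ m * (((b * k + i : ℕ) : ℝ) / (b : ℝ) ^ (N + 2))
          = - ((b : ℝ) ^ m * (((i : ℝ) / b) / (b : ℝ) ^ (N + 1))) := by
        push_cast; field_simp; ring
      rw [e4, abs_neg, abs_of_nonneg (by positivity)]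
      calc L * ((b : ℝ) ^ m * (((i : ℝ) / b) / (b : ℝ) ^ (N + 1)))
          ≤ L * ((b : ℝ) ^ m * (1 / (b : ℝ) ^ (N + 1))) := by gcongr
        _ = _ := by ring
    refine h1.trans ?_
    rw [← Finset.sum_mul, geom_sum_eq hr1.ne']
    have hpos : 0 < lam * b - 1 := by linarith
    calc ((lam * b) ^ N - 1) / (lam * b - 1) * (L / (b : ℝ) ^ (N + 1))
        ≤ ((lam * b) ^ N) / (lam * b - 1) * (L / (b : ℝ) ^ (N + 1)) := by
          gcongr; linarith
      _ = lam ^ (N + 1) * (L / (lam * b * (lam * b - 1))) := by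
          rw [mul_pow]; field_simp; ring
  have hnum := aux_num L ε c₁ b lam hε hL hc₁1 hc₁ hb0 hlam0 hlam1
    (lt_of_le_of_lt (le_max_left _ _) hcond)
  have key : p - (S' + lam ^ N • φ ((k : ℝ) / b + (i : ℝ) / b / b) + lam ^ (N + 1) • φ ((i : ℝ) / b))
      - lam ^ (N + 2) • (φ t' + lam⁻¹ • (φ ((i : ℝ) / b + t' / b) - φ ((i : ℝ) / b)))
      = (S - S') + lam ^ (N + 1) • ((φ s' - φ ((i : ℝ) / b))
        + lam⁻¹ • (φ ((k : ℝ) / b + s' / b) - φ ((k : ℝ) / b + (i : ℝ) / b / b))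
        - (φ ((i : ℝ) / b + t' / b) - φ ((i : ℝ) / b))) := by
    rw [hpu, hAS, ht]
    have e5 : lam ^ N = lam ^ (N + 1) * lam⁻¹ := by field_simp; ring
    have e6 : lam ^ (N + 2) = lam ^ (N + 1) * lam := by ring
    have e7 : lam ^ (N + 2) * lam⁻¹ = lam ^ (N + 1) := by field_simp; ring
    rw [smul_add (lam ^ (N + 2)), smul_smul (lam ^ (N + 2)), e7, e6, e5]
    module
  rw [key]
  have hsi : |s' - (i : ℝ) / b| ≤ 1 / b := by
    rw [abs_of_nonneg (by linarith)]
    rw [add_div] at hi2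
    linarith
  have n1 : ‖φ s' - φ ((i : ℝ) / b)‖ ≤ L / b := by
    refine (hLip _ _).trans ?_
    calc L * |s' - (i : ℝ) / b| ≤ L * (1 / b) := by gcongr
      _ = _ := by ring
  have n2 : ‖lam⁻¹ • (φ ((k : ℝ) / b + s' / b) - φ ((k : ℝ) / b + (i : ℝ) / b / b))‖
      ≤ L / (lam * b ^ 2) := by
    rw [norm_smul, norm_inv, Real.norm_of_nonneg hlam0.le]
    have e : (k : ℝ) / b + s' / b - ((k : ℝ) / b + (i : ℝ) / b / b) = (s' - (i : ℝ) / b) / b := by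
      ring
    have h := hLip ((k : ℝ) / b + s' / b) ((k : ℝ) / b + (i : ℝ) / b / b)
    rw [e, abs_div, abs_of_pos hb0] at h
    calc _ ≤ lam⁻¹ * (L * ((1 / b) / b)) := by
          gcongr
          exact h.trans (by gcongr)
      _ = _ := by field_simp
  have n3 : ‖φ ((i : ℝ) / b + t' / b) - φ ((i : ℝ) / b)‖ ≤ L / b := by
    refine (hLip _ _).trans ?_
    rw [add_sub_cancel_left, abs_of_nonneg (by positivity)]
    calc L * (t' / b) ≤ L * (1 / b) := by gcongr
      _ = _ := by ring
  have n4 : ‖(φ s' - φ ((i : ℝ) / b))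
        + lam⁻¹ • (φ ((k : ℝ) / b + s' / b) - φ ((k : ℝ) / b + (i : ℝ) / b / b))
        - (φ ((i : ℝ) / b + t' / b) - φ ((i : ℝ) / b))‖ ≤ L / b + L / (lam * b ^ 2) + L / b := by
    refine (norm_sub_le _ _).trans (add_le_add ((norm_add_le _ _).trans (add_le_add n1 n2)) n3)
  calc _ ≤ lam ^ (N + 1) * (L / (lam * b * (lam * b - 1)))
        + lam ^ (N + 1) * (L / b + L / (lam * b ^ 2) + L / b) := by
        refine (norm_add_le _ _).trans (add_le_add hslow ?_)
        rw [norm_smul, Real.norm_of_nonneg hlN.le]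
        gcongr
    _ = lam ^ (N + 1) * (L / b + L / (lam * b ^ 2) + L / (lam * b * (lam * b - 1)) + L / b) := by
        ring
    _ < lam ^ (N + 1) * (ε * lam ^ 2) := by gcongr
    _ = _ := by ring

end Aux

open scoped Pointwise

/-- Under the separation condition, with `c₁ > 1` solving
`c₁ = (L/ε)(4 + 1/(c₁−1))`, `c₂ = max{c₁, 2L/Δ(φ)}`, `b ≥ 2`, `λ ∈ (0,1/2)` and
`bλ² > c₂`, for all `n ≥ 1` and `0 ≤ k < b^n`:
`W(k/b^n) − (λ^n/(1−λ))φ(0) + λ^n(ℓ̂_{k/b} + B(0,ελ)) ⊆ {W(s) : s ∈ [k/b^n,(k+1)/b^n]}`,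
where `ℓ_β(s) = φ(s) + λ⁻¹(φ(β+s/b) − φ(β))`. -/
theorem stmt10 (φ : ℝ → EuclideanSpace ℝ (Fin 2)) (L ε : ℝ) (hε : 0 < ε)
    (hper : ∀ x : ℝ, φ (x + 1) = φ x)
    (hLip : ∀ x y : ℝ, ‖φ x - φ y‖ ≤ L * |x - y|)
    (hball : Metric.ball (0 : EuclideanSpace ℝ (Fin 2)) ε ⊆ (Set.range φ)ᶜ)
    (hbd : Bornology.IsBounded (connectedComponentIn (Set.range φ)ᶜ 0))
    (c₁ : ℝ) (hc₁1 : 1 < c₁) (hc₁ : c₁ = (L / ε) * (4 + 1 / (c₁ - 1)))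
    (b : ℕ) (hb : 2 ≤ b) (lam : ℝ) (hlam0 : 0 < lam) (hlam1 : lam < 1 / 2)
    (hcond : (b : ℝ) * lam ^ 2 > max c₁ (2 * L / Metric.diam (Set.range φ)))
    (W : ℝ → EuclideanSpace ℝ (Fin 2))
    (hW : ∀ x : ℝ, W x = ∑' m : ℕ, lam ^ m • φ ((b : ℝ) ^ m * x)) :
    ∀ n : ℕ, 1 ≤ n → ∀ k : ℕ, k < b ^ n →
      ∀ u ∈ ((fun s : ℝ => φ s + lam⁻¹ •
                (φ ((k : ℝ) / (b : ℝ) + s / (b : ℝ)) - φ ((k : ℝ) / (b : ℝ)))) ''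
              Set.Ico (0 : ℝ) 1) +
            Metric.ball (0 : EuclideanSpace ℝ (Fin 2)) (ε * lam),
        W ((k : ℝ) / (b : ℝ) ^ n) - (lam ^ n / (1 - lam)) • φ 0 + lam ^ n • u ∈
          W '' Set.Icc ((k : ℝ) / (b : ℝ) ^ n) (((k : ℝ) + 1) / (b : ℝ) ^ n) := by
  have hL : 0 ≤ L := by
    have := hLip 1 0
    simp only [sub_zero, abs_one, mul_one] at this
    exact (norm_nonneg _).trans this
  have hcont : Continuous φ := by
    have : LipschitzWith ⟨L, hL⟩ φ := LipschitzWith.of_dist_le_mul fun x y => by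
      rw [dist_eq_norm, Real.dist_eq]; exact hLip x y
    exact this.continuous
  have hP : Function.Periodic φ 1 := hper
  have hK : Bornology.IsBounded (Set.range φ) :=
    (hP.compact_of_continuous one_ne_zero hcont).isBounded
  obtain ⟨M, hM⟩ : ∃ M, ∀ x, ‖φ x‖ ≤ M := by
    obtain ⟨M, hM⟩ := hK.exists_norm_le
    exact ⟨M, fun x => hM _ ⟨x, rfl⟩⟩
  have hM0 : 0 ≤ M := (norm_nonneg _).trans (hM 0)
  have hE : ∃ w : EuclideanSpace ℝ (Fin 2), w ≠ 0 := exists_ne 0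
  have hb0 : (0 : ℝ) < b := by positivity
  have hlam1' : lam < 1 := by linarith
  have hgeo : Summable fun m : ℕ => lam ^ m * M :=
    (summable_geometric_of_lt_one hlam0.le hlam1').mul_right M
  have hbnd : ∀ (m : ℕ) (x : ℝ), ‖lam ^ m • φ ((b : ℝ) ^ m * x)‖ ≤ lam ^ m * M := by
    intro m x
    rw [norm_smul, Real.norm_of_nonneg (by positivity)]
    gcongr
    exact hM _
  have hWc : Continuous W := by
    have : W = fun x => ∑' m : ℕ, lam ^ m • φ ((b : ℝ) ^ m * x) := funext hW
    rw [this]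
    exact continuous_tsum (fun m => by fun_prop) hgeo hbnd
  have hWk : ∀ n k : ℕ, W ((k : ℝ) / (b : ℝ) ^ n) =
      ∑ m ∈ Finset.range n, lam ^ m • φ ((b : ℝ) ^ m * ((k : ℝ) / (b : ℝ) ^ n))
        + (lam ^ n / (1 - lam)) • φ 0 := by
    intro n k
    have hsum : Summable fun m : ℕ => lam ^ m • φ ((b : ℝ) ^ m * ((k : ℝ) / (b : ℝ) ^ n)) :=
      Summable.of_norm_bounded hgeo fun m => hbnd m _
    rw [hW, ← hsum.sum_add_tsum_nat_add n]
    congr 1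
    have h1 : ∀ m : ℕ, lam ^ (m + n) • φ ((b : ℝ) ^ (m + n) * ((k : ℝ) / (b : ℝ) ^ n))
        = (lam ^ m) • (lam ^ n • φ 0) := by
      intro m
      have e : (b : ℝ) ^ (m + n) * ((k : ℝ) / (b : ℝ) ^ n) = ((b ^ m * k : ℕ) : ℝ) := by
        push_cast; rw [pow_add]; field_simp
      have := hP.nat_mul (b ^ m * k) 0
      rw [zero_add, mul_one] at this
      rw [e, this, smul_smul, pow_add]
    simp_rw [h1]
    rw [Summable.tsum_smul_const (summable_geometric_of_lt_one hlam0.le hlam1'),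
      tsum_geometric_of_lt_one hlam0.le hlam1', smul_smul]
    congr 1
    ring
  intro n hn k hk u hu
  obtain ⟨N, rfl⟩ : ∃ N, n = N + 1 := ⟨n - 1, by omega⟩
  obtain ⟨_, ⟨s, hs, rfl⟩, v, hv, rfl⟩ := hu
  rw [hWk, add_sub_cancel_right]
  set p := ∑ m ∈ Finset.range (N + 1), lam ^ m • φ ((b : ℝ) ^ m * ((k : ℝ) / (b : ℝ) ^ (N + 1)))
    + lam ^ (N + 1) • ((fun s : ℝ => φ s + lam⁻¹ •
      (φ ((k : ℝ) / (b : ℝ) + s / (b : ℝ)) - φ ((k : ℝ) / (b : ℝ)))) s + v) with hp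
  have hnest : ∀ j : ℕ, ∃ K : ℕ, b ^ j * k ≤ K ∧ K + 1 ≤ b ^ j * (k + 1) ∧
      ∃ s ∈ Set.Icc (0 : ℝ) 1,
      ‖p - ∑ m ∈ Finset.range (N + j + 1),
          lam ^ m • φ ((b : ℝ) ^ m * ((K : ℝ) / (b : ℝ) ^ (N + j + 1)))
        - lam ^ (N + j + 1) • (φ s + lam⁻¹ • (φ ((K : ℝ) / b + s / b) - φ ((K : ℝ) / b)))‖
        < lam ^ (N + j + 1) * (ε * lam) := by
    intro j
    induction j with
    | zero =>
      refine ⟨k, by simp, by simp, s, ⟨hs.1, hs.2.le⟩, ?_⟩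
      rw [mem_ball_zero_iff] at hv
      simp only [hp, add_zero]
      rw [add_sub_cancel_left, ← smul_sub, add_sub_cancel_left, norm_smul,
        Real.norm_of_nonneg (by positivity)]
      gcongr
    | succ j ih =>
      obtain ⟨K, hK1, hK2, s, hs, h⟩ := ih
      obtain ⟨i, hi, t, ht, h'⟩ := aux_step φ L ε hε hE hper hLip hcont hK hball hbd c₁ hc₁1 hc₁ b hb
        lam hlam0 hlam1 hcond (N + j) K p s hs h
      refine ⟨b * K + i, ?_, ?_, t, ht, h'⟩
      · have := Nat.mul_le_mul_left b hK1
        rw [pow_succ']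
        nlinarith
      · have := Nat.mul_le_mul_left b hK2
        rw [pow_succ']
        nlinarith
  have hclosed : IsClosed (W '' Set.Icc ((k : ℝ) / (b : ℝ) ^ (N + 1))
      (((k : ℝ) + 1) / (b : ℝ) ^ (N + 1))) := (isCompact_Icc.image hWc).isClosed
  rw [← hclosed.closure_eq, Metric.mem_closure_iff]
  intro δ hδ
  set Q : ℝ := ε * lam + (M + lam⁻¹ * (M + M)) + (1 / (1 - lam)) * M with hQ
  have hlp : 0 < 1 - lam := by linarith
  have hQp : 0 < Q := by positivity
  obtain ⟨j, hj⟩ := exists_pow_lt_of_lt_one (div_pos hδ hQp) hlam1'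
  obtain ⟨K, hK1, hK2, s, hs, h⟩ := hnest j
  refine ⟨_, ⟨(K : ℝ) / (b : ℝ) ^ (N + j + 1), ⟨?_, ?_⟩, rfl⟩, ?_⟩
  · rw [div_le_div_iff₀ (by positivity) (by positivity)]
    have : (b : ℝ) ^ j * k ≤ K := by exact_mod_cast hK1
    calc (k : ℝ) * (b : ℝ) ^ (N + j + 1) = ((b : ℝ) ^ j * k) * (b : ℝ) ^ (N + 1) := by ring
      _ ≤ _ := by gcongr
  · rw [div_le_div_iff₀ (by positivity) (by positivity)]
    have : (K : ℝ) + 1 ≤ (b : ℝ) ^ j * (k + 1) := by exact_mod_cast hK2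
    calc (K : ℝ) * (b : ℝ) ^ (N + 1) ≤ ((b : ℝ) ^ j * (k + 1)) * (b : ℝ) ^ (N + 1) := by
          gcongr; linarith
      _ = _ := by ring
  · rw [dist_eq_norm, hWk]
    set A := ∑ m ∈ Finset.range (N + j + 1),
          lam ^ m • φ ((b : ℝ) ^ m * ((K : ℝ) / (b : ℝ) ^ (N + j + 1)))
    set l := φ s + lam⁻¹ • (φ ((K : ℝ) / b + s / b) - φ ((K : ℝ) / b)) with hl
    have e : p - (A + (lam ^ (N + j + 1) / (1 - lam)) • φ 0) =
      (p - A - lam ^ (N + j + 1) • l) + lam ^ (N + j + 1) • l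
        - (lam ^ (N + j + 1) / (1 - lam)) • φ 0 := by abel
    have hln : ‖l‖ ≤ M + lam⁻¹ * (M + M) := by
      rw [hl]
      refine (norm_add_le _ _).trans (add_le_add (hM _) ?_)
      rw [norm_smul, norm_inv, Real.norm_of_nonneg hlam0.le]
      gcongr
      exact (norm_sub_le _ _).trans (add_le_add (hM _) (hM _))
    have h2 : ‖lam ^ (N + j + 1) • l‖ ≤ lam ^ (N + j + 1) * (M + lam⁻¹ * (M + M)) := by
      rw [norm_smul, Real.norm_of_nonneg (by positivity)]
      gcongr
    have h3 : ‖(lam ^ (N + j + 1) / (1 - lam)) • φ 0‖ ≤ lam ^ (N + j + 1) * ((1 / (1 - lam)) * M) := by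
      rw [norm_smul, Real.norm_of_nonneg (by positivity)]
      calc _ ≤ lam ^ (N + j + 1) / (1 - lam) * M := by gcongr; exact hM _
        _ = _ := by ring
    rw [e]
    calc _ ≤ lam ^ (N + j + 1) * (ε * lam) + lam ^ (N + j + 1) * (M + lam⁻¹ * (M + M))
          + lam ^ (N + j + 1) * ((1 / (1 - lam)) * M) :=
          (norm_sub_le _ _).trans
            (add_le_add ((norm_add_le _ _).trans (add_le_add h.le h2)) h3)
      _ = lam ^ (N + j + 1) * Q := by rw [hQ]; ring
      _ ≤ lam ^ j * Q := by
          gcongr ?_ * Q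
          exact pow_le_pow_of_le_one hlam0.le hlam1'.le (by omega)
      _ < δ := by rwa [lt_div_iff₀ hQp] at hj
end

section
/- Let φ : ℝ → ℝ² be a ℤ-periodic Lipschitz function such that ℝ² \ φ̂ is not connected, where φ̂ is the image of φ. Then there exists a constant c > 0 depending only on φ such that for every integer b ≥ 2 and λ ∈ (0,1) with bλ² > c, the box dimension (upper and lower coincide) of the graph {(x, W(x)) : x ∈ [0,1]} ⊆ ℝ³ of W(x) = Σ_{n=0}^∞ λ^n φ(b^n x) equals 3 + 2 log_b λ. -/
/-- Number of generation-`n` `b`-adic cubes of `ℝ³` meeting `A`. -/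
noncomputable def boxCount (b n : ℕ) (A : Set (Fin 3 → ℝ)) : ℕ :=
  Set.ncard {k : Fin 3 → ℤ | ∃ p ∈ A, ∀ i : Fin 3,
    (k i : ℝ) / (b : ℝ) ^ n ≤ p i ∧ p i < ((k i : ℝ) + 1) / (b : ℝ) ^ n}

/-- Upper box dimension of `A ⊆ ℝ³` via `b`-adic cube counting. -/
noncomputable def upperBoxDim (b : ℕ) (A : Set (Fin 3 → ℝ)) : ℝ :=
  Filter.limsup (fun n : ℕ => Real.log (boxCount b n A) / (n * Real.log b)) Filter.atTop

/-- Lower box dimension of `A ⊆ ℝ³` via `b`-adic cube counting. -/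
noncomputable def lowerBoxDim (b : ℕ) (A : Set (Fin 3 → ℝ)) : ℝ :=
  Filter.liminf (fun n : ℕ => Real.log (boxCount b n A) / (n * Real.log b)) Filter.atTop

open Set Filter Topology Metric

abbrev E2 := EuclideanSpace ℝ (Fin 2)

lemma crossing {s V : Set E2} (hs : IsPreconnected s) (hV : IsOpen V)
    (h1 : (s ∩ V).Nonempty) (h2 : ∃ x ∈ s, x ∉ V) : ∃ x ∈ s, x ∈ frontier V := by
  by_contra hcon
  push Not at hcon
  have hsub : s ⊆ V ∪ (closure V)ᶜ := by
    intro x hx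
    by_cases hxV : x ∈ V
    · exact Or.inl hxV
    · right
      intro hc
      exact hcon x hx (by rw [hV.frontier_eq]; exact ⟨hc, hxV⟩)
  have hd : Disjoint V (closure V)ᶜ :=
    disjoint_compl_right_iff_subset.mpr subset_closure
  rcases hs.subset_or_subset hV isClosed_closure.isOpen_compl hd hsub with h | h
  · obtain ⟨x, hx, hxV⟩ := h2
    exact hxV (h hx)
  · obtain ⟨x, hx, hxV⟩ := h1
    exact h hx (subset_closure hxV)

lemma exterior_preconnected (R : ℝ) (hR : 0 ≤ R) :
    IsPreconnected {x : E2 | R < ‖x‖} := by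
  have h1 : IsPreconnected (sphere (0 : E2) 1) := by
    apply isPreconnected_sphere
    rw [← Module.finrank_eq_rank, finrank_euclideanSpace_fin]
    norm_num
  have h2 : IsPreconnected ((Ioi R) ×ˢ (sphere (0 : E2) 1)) := isPreconnected_Ioi.prod h1
  have h3 := h2.image (fun p : ℝ × E2 => p.1 • p.2) (by fun_prop)
  convert h3 using 1
  ext x
  simp only [mem_ofPred_eq, mem_image, mem_prod, mem_Ioi, mem_sphere, dist_zero_right, Prod.exists]
  constructor
  · intro hx
    have hx0 : ‖x‖ ≠ 0 := by linarith
    refine ⟨‖x‖, ‖x‖⁻¹ • x, ⟨hx, ?_⟩, ?_⟩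
    · rw [norm_smul, norm_inv, norm_norm, inv_mul_cancel₀ hx0]
    · rw [smul_smul, mul_inv_cancel₀ hx0, one_smul]
  · rintro ⟨a, v, ⟨ha, hv⟩, rfl⟩
    rw [norm_smul, hv, mul_one, Real.norm_eq_abs]
    exact lt_of_lt_of_le ha (le_abs_self a)

lemma exists_U (S : Set E2) (hS : IsCompact S) (hdisc : ¬ IsConnected Sᶜ) :
    ∃ U : Set E2, IsOpen U ∧ U.Nonempty ∧ Bornology.IsBounded U ∧ Disjoint U S ∧
      frontier U ⊆ S := by
  obtain ⟨R0, hR0⟩ := hS.isBounded.subset_closedBall 0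
  set R := max R0 0
  have hSR : ∀ x ∈ S, ‖x‖ ≤ R := fun x hx =>
    le_trans (by simpa using hR0 hx) (le_max_left _ _)
  have hext := exterior_preconnected R (le_max_right _ _)
  have hextS : {x : E2 | R < ‖x‖} ⊆ Sᶜ := fun x hx hxS => absurd (hSR x hxS) (not_le.mpr hx)
  have hne : (Sᶜ).Nonempty := by
    obtain ⟨x, hx⟩ := NormedSpace.exists_lt_norm ℝ E2 R
    exact ⟨x, hextS hx⟩
  have hnp : ¬ IsPreconnected Sᶜ := fun h => hdisc ⟨hne, h⟩
  have hO : IsOpen Sᶜ := hS.isClosed.isOpen_compl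
  unfold IsPreconnected at hnp
  push Not at hnp
  obtain ⟨u, v, hu, hv, huv, hun, hvn, hemp⟩ := hnp
  have key : ∀ u v : Set E2, IsOpen u → IsOpen v → Sᶜ ⊆ u ∪ v → (Sᶜ ∩ v).Nonempty →
      (Sᶜ ∩ (u ∩ v)) = ∅ → {x : E2 | R < ‖x‖} ⊆ Sᶜ ∩ u →
      ∃ U : Set E2, IsOpen U ∧ U.Nonempty ∧ Bornology.IsBounded U ∧ Disjoint U S ∧
      frontier U ⊆ S := by
    intro u v hu hv huv hvn hemp hsub
    refine ⟨Sᶜ ∩ v, hO.inter hv, hvn, ?_, ?_, ?_⟩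
    · apply (isBounded_closedBall (x := (0 : E2)) (r := R)).subset
      intro x hx
      by_contra hxR
      have : R < ‖x‖ := by simpa using hxR
      have h1 := hsub this
      have : x ∈ Sᶜ ∩ (u ∩ v) := ⟨hx.1, h1.2, hx.2⟩
      rw [hemp] at this
      exact this
    · rw [Set.disjoint_left]
      exact fun x hx => hx.1
    · intro x hx
      rw [(hO.inter hv).frontier_eq] at hx
      by_contra hxS
      have hxu : x ∈ u := by
        rcases huv hxS with h | h
        · exact h
        · exact absurd ⟨hxS, h⟩ hx.2
      obtain ⟨w, hw1, hw2⟩ := mem_closure_iff.mp hx.1 (Sᶜ ∩ u) (hO.inter hu) ⟨hxS, hxu⟩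
      have : w ∈ Sᶜ ∩ (u ∩ v) := ⟨hw1.1, hw1.2, hw2.2⟩
      rw [hemp] at this
      exact this
  have hdis : Disjoint (Sᶜ ∩ u) (Sᶜ ∩ v) := by
    rw [Set.disjoint_left]
    intro x h1 h2
    have : x ∈ Sᶜ ∩ (u ∩ v) := ⟨h1.1, h1.2, h2.2⟩
    rw [hemp] at this
    exact this
  rcases hext.subset_or_subset (hO.inter hu) (hO.inter hv) hdis (by
    intro x hx
    rcases huv (hextS hx) with h | h
    · exact Or.inl ⟨hextS hx, h⟩
    · exact Or.inr ⟨hextS hx, h⟩) with h | h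
  · exact key u v hu hv huv hvn hemp h
  · exact key v u hv hu (by rwa [union_comm]) hun (by rwa [inter_comm v u]) h

/-- From a point of `U`, any ray hits `S` at distance at least `δ`. -/
lemma ray_hit {S U : Set E2} (hU : IsOpen U) (hb : Bornology.IsBounded U) (hfr : frontier U ⊆ S)
    {x : E2} (hx : x ∈ U) {δ : ℝ} (hδ : δ ≤ infDist x S) (v : E2) (hv : ‖v‖ = 1) :
    ∃ s : ℝ, δ ≤ s ∧ x + s • v ∈ S := by
  have hray : IsPreconnected ((fun s : ℝ => x + s • v) '' Ici 0) :=
    isPreconnected_Ici.image _ (by fun_prop)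
  obtain ⟨R, hR⟩ := hb.subset_closedBall x
  obtain ⟨p, ⟨s, hs, rfl⟩, hp⟩ := crossing hray hU ⟨x, ⟨0, by simp, by simp⟩, hx⟩ (by
    refine ⟨x + (|R| + 1) • v, ⟨|R| + 1, by simp; positivity, rfl⟩, fun h => ?_⟩
    have := hR h
    rw [mem_closedBall, dist_eq_norm, add_sub_cancel_left, norm_smul, hv, mul_one,
      Real.norm_eq_abs, abs_of_nonneg (by positivity)] at this
    linarith [le_abs_self R])
  refine ⟨s, ?_, hfr hp⟩
  have h1 := infDist_le_dist_of_mem (x := x) (hfr hp)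
  rw [dist_eq_norm, sub_add_cancel_left, norm_neg, norm_smul, hv, mul_one,
      Real.norm_eq_abs, abs_of_nonneg hs] at h1
  linarith

lemma ray_coord {S U : Set E2} (hU : IsOpen U) (hb : Bornology.IsBounded U) (hfr : frontier U ⊆ S)
    {x : E2} (hx : x ∈ U) {δ : ℝ} (hδ : δ ≤ infDist x S) :
    (∃ p ∈ S, x 0 + δ ≤ p 0) ∧ (∃ p ∈ S, p 0 ≤ x 0 - δ) := by
  constructor
  · obtain ⟨s, hs, hp⟩ := ray_hit hU hb hfr hx hδ (EuclideanSpace.single 0 1) (by simp)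
    exact ⟨_, hp, by simp; exact hs⟩
  · obtain ⟨s, hs, hp⟩ := ray_hit hU hb hfr hx hδ (-EuclideanSpace.single 0 1) (by simp)
    exact ⟨_, hp, by simp; linarith⟩

/-- The shrunken domain. -/
def VV (S U : Set E2) (ε : ℝ) : Set E2 := U ∩ {x | ε < infDist x S}

lemma VV_open {S U : Set E2} (hU : IsOpen U) (ε : ℝ) : IsOpen (VV S U ε) :=
  hU.inter (isOpen_lt continuous_const (continuous_infDist_pt S))

lemma VV_frontier {S U : Set E2} (hU : IsOpen U) (hfr : frontier U ⊆ S) {ε : ℝ} (hε : 0 < ε)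
    {x : E2} (hx : x ∈ frontier (VV S U ε)) : infDist x S ≤ ε := by
  rw [(VV_open hU ε).frontier_eq] at hx
  obtain ⟨h1, h2⟩ := hx
  by_contra hcon
  push Not at hcon
  apply h2
  refine ⟨?_, hcon⟩
  by_contra hxU
  have hxc : x ∈ closure U := closure_mono inter_subset_left h1
  have : x ∈ S := hfr (by rw [hU.frontier_eq]; exact ⟨hxc, hxU⟩)
  rw [infDist_zero_of_mem this] at hcon
  linarith

lemma step {φ : ℝ → E2} (hφ : Continuous φ) (hS : range φ = φ '' Icc 0 1) {U : Set E2}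
    (hU : IsOpen U) (hb : Bornology.IsBounded U) (hfr : frontier U ⊆ range φ)
    (hdisj : Disjoint U (range φ)) {κ lam e : ℝ} (hκ : 0 < κ) (hball : ball 0 κ ⊆ U)
    (hl0 : 0 < lam) (hl1 : lam < 1) (he : 8 * e < κ * lam)
    {z : E2} (hz : z ∈ frontier (VV (range φ) U (κ * lam / 4)))
    {g : ℝ → E2} (hg : Continuous g) (hgz : ∀ t ∈ Icc (0 : ℝ) 1, ‖g t - z‖ ≤ 2 * e) :
    ∃ t ∈ Icc (0 : ℝ) 1, lam⁻¹ • (g t - φ t) ∈ frontier (VV (range φ) U (κ * lam / 4)) := by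
  have hε : 0 < κ * lam / 4 := by positivity
  have hcomp : IsCompact (range φ) := by rw [hS]; exact isCompact_Icc.image hφ
  have hconn : IsPreconnected ((fun t => lam⁻¹ • (g t - φ t)) '' Icc 0 1) :=
    isPreconnected_Icc.image _ (by fun_prop)
  have hne : (range φ).Nonempty := range_nonempty φ
  have hinf : ∀ x : E2, ‖x‖ < κ → κ - ‖x‖ ≤ infDist x (range φ) := by
    intro x hx
    rw [le_infDist hne]
    intro p hp
    have hpn : κ ≤ ‖p‖ := by
      by_contra h
      push Not at h
      exact Set.disjoint_left.mp hdisj (hball (by simpa using h)) hp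
    rw [dist_eq_norm]
    have := norm_sub_norm_le p x
    rw [norm_sub_rev] at this
    linarith
  obtain ⟨w, ⟨t, ht, rfl⟩, hw⟩ := crossing hconn (VV_open (S := range φ) hU (κ * lam / 4)) (by
    obtain ⟨p, hp, hpd⟩ := hcomp.exists_infDist_eq_dist hne z
    have hpd' : dist z p ≤ κ * lam / 4 := by rw [← hpd]; exact VV_frontier hU hfr hε hz
    rw [hS] at hp
    obtain ⟨t, ht, rfl⟩ := hp
    refine ⟨_, ⟨t, ht, rfl⟩, ?_⟩
    have h1 : ‖g t - φ t‖ < κ * lam / 2 := by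
      have : g t - φ t = (g t - z) + (z - φ t) := by abel
      rw [this]
      have h2 := norm_add_le (g t - z) (z - φ t)
      rw [dist_eq_norm] at hpd'
      have := hgz t ht
      linarith
    have h2 : ‖lam⁻¹ • (g t - φ t)‖ < κ / 2 := by
      rw [norm_smul, norm_inv, Real.norm_eq_abs, abs_of_pos hl0, inv_mul_lt_iff₀ hl0]
      linarith
    refine ⟨hball (by rw [mem_ball_zero_iff]; linarith), ?_⟩
    have h3 := hinf _ (lt_trans h2 (by linarith))
    show κ * lam / 4 < _
    nlinarith) (by
    by_contra hcon
    push Not at hcon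
    have hin : ∀ t ∈ Icc (0 : ℝ) 1, lam⁻¹ • (g t - φ t) ∈ VV (range φ) U (κ * lam / 4) :=
      fun t ht => hcon _ ⟨t, ht, rfl⟩
    have hc0 : ContinuousOn (fun t => φ t 0) (Icc 0 1) := by fun_prop
    obtain ⟨tM, htM, hM⟩ := isCompact_Icc.exists_isMaxOn (nonempty_Icc.mpr zero_le_one) hc0
    obtain ⟨tm, htm, hm⟩ := isCompact_Icc.exists_isMinOn (nonempty_Icc.mpr zero_le_one) hc0
    have hM' : ∀ p ∈ range φ, p 0 ≤ φ tM 0 := by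
      rw [hS]; rintro _ ⟨t, ht, rfl⟩; exact hM ht
    have hm' : ∀ p ∈ range φ, φ tm 0 ≤ p 0 := by
      rw [hS]; rintro _ ⟨t, ht, rfl⟩; exact hm ht
    have h0 := ray_coord (x := 0) hU hb hfr (hball (by simpa using hκ)) (hinf 0 (by simpa using hκ))
    obtain ⟨⟨p, hp, hp0⟩, ⟨q, hq, hq0⟩⟩ := h0
    have hMp := hM' p hp
    have hmq := hm' q hq
    simp at hp0 hq0
    obtain ⟨⟨p', hp', hp0'⟩, -⟩ := ray_coord hU hb hfr (hin tm htm).1 (le_of_lt (hin tm htm).2)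
    obtain ⟨-, ⟨q', hq', hq0'⟩⟩ := ray_coord hU hb hfr (hin tM htM).1 (le_of_lt (hin tM htM).2)
    have hMp' := hM' p' hp'
    have hmq' := hm' q' hq'
    have hga := (PiLp.norm_apply_le (g tm - z) 0).trans (hgz tm htm)
    have hgb := (PiLp.norm_apply_le (g tM - z) 0).trans (hgz tM htM)
    simp only [PiLp.sub_apply, PiLp.smul_apply, smul_eq_mul, Real.norm_eq_abs, abs_le] at *
    set M := φ tM 0
    set m := φ tm 0
    have e1 : g tm 0 - m ≤ lam * (M - κ * lam / 4) := by
      have : lam⁻¹ * (g tm 0 - m) ≤ M - κ * lam / 4 := by linarith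
      rwa [inv_mul_le_iff₀ hl0] at this
    have e2 : lam * (m + κ * lam / 4) ≤ g tM 0 - M := by
      have : m + κ * lam / 4 ≤ lam⁻¹ * (g tM 0 - M) := by linarith
      rwa [le_inv_mul_iff₀ hl0] at this
    have e3 : M - m - 4 * e ≤ lam * (M - m) - lam * (κ * lam / 2) := by linarith
    have e4 : 2 * κ ≤ M - m := by linarith
    have e5 : (1 - lam) * (2 * κ) ≤ (1 - lam) * (M - m) :=
      mul_le_mul_of_nonneg_left e4 (by linarith)
    have e6 : 0 ≤ κ * (1 - lam) * (2 - lam / 2) := by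
      apply mul_nonneg (mul_nonneg hκ.le (by linarith)) (by linarith)
    nlinarith)
  exact ⟨t, ht, hw⟩

/-- Partial sums. -/
noncomputable def SS (φ : ℝ → E2) (lam : ℝ) (b n : ℕ) (x : ℝ) : E2 :=
  ∑ m ∈ Finset.range n, lam ^ m • φ ((b : ℝ) ^ m * x)

lemma SS_cont {φ : ℝ → E2} (hφ : Continuous φ) (lam : ℝ) (b n : ℕ) :
    Continuous (SS φ lam b n) := by
  unfold SS
  fun_prop

lemma SS_lip {φ : ℝ → E2} {K : ℝ} (hK : 0 ≤ K) (hLip : ∀ x y, ‖φ x - φ y‖ ≤ K * |x - y|)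
    {lam : ℝ} {b : ℕ} (hl0 : 0 < lam) (hq : 2 ≤ lam * b) (n : ℕ) (x y : ℝ) :
    ‖SS φ lam b n x - SS φ lam b n y‖ ≤ 2 * K / (lam * b) * (lam * b) ^ n * |x - y| := by
  have hq0 : 0 < lam * b := by linarith
  induction n with
  | zero => simp [SS]; positivity
  | succ n ih =>
    have h1 : SS φ lam b (n + 1) x - SS φ lam b (n + 1) y
        = (SS φ lam b n x - SS φ lam b n y)
          + lam ^ n • (φ ((b : ℝ) ^ n * x) - φ ((b : ℝ) ^ n * y)) := by
      simp only [SS, Finset.sum_range_succ, smul_sub]; abel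
    rw [h1]
    refine (norm_add_le _ _).trans ?_
    have h2 : ‖lam ^ n • (φ ((b : ℝ) ^ n * x) - φ ((b : ℝ) ^ n * y))‖
        ≤ K * (lam * b) ^ n * |x - y| := by
      rw [norm_smul, Real.norm_eq_abs, abs_of_pos (by positivity)]
      have := hLip ((b : ℝ) ^ n * x) ((b : ℝ) ^ n * y)
      rw [← mul_sub, abs_mul, abs_of_nonneg (by positivity : (0 : ℝ) ≤ (b : ℝ) ^ n)] at this
      calc lam ^ n * ‖φ ((b : ℝ) ^ n * x) - φ ((b : ℝ) ^ n * y)‖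
          ≤ lam ^ n * (K * ((b : ℝ) ^ n * |x - y|)) := by gcongr
        _ = _ := by rw [mul_pow]; ring
    have h3 : 2 * K / (lam * b) * (lam * b) ^ (n + 1) = 2 * K * (lam * b) ^ n := by
      rw [pow_succ, mul_comm ((lam * b) ^ n), ← mul_assoc, div_mul_cancel₀ _ hq0.ne']
    have h4 : 2 * K / (lam * b) ≤ K := by
      rw [div_le_iff₀ hq0]; nlinarith
    rw [h3]
    have h5 : 2 * K / (lam * b) * (lam * b) ^ n * |x - y| ≤ K * (lam * b) ^ n * |x - y| := by
      gcongr
    linarith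

lemma exists_digit {b : ℕ} (hb : 1 ≤ b) {t : ℝ} (ht : t ∈ Icc (0 : ℝ) 1) :
    ∃ i : ℕ, i + 1 ≤ b ∧ (i : ℝ) ≤ b * t ∧ (b : ℝ) * t ≤ i + 1 := by
  rcases eq_or_lt_of_le ht.2 with h | h
  · refine ⟨b - 1, by omega, ?_, ?_⟩
    · subst h; push_cast [hb]; linarith
    · subst h; push_cast [hb]; linarith
  · have hb0 : (0 : ℝ) < b := by exact_mod_cast hb
    have hnn : 0 ≤ (b : ℝ) * t := mul_nonneg hb0.le ht.1
    refine ⟨⌊(b : ℝ) * t⌋₊, ?_, Nat.floor_le hnn, (Nat.lt_floor_add_one _).le⟩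
    have : (b : ℝ) * t < b := by nlinarith
    exact (Nat.floor_lt hnn).mpr this

section
variable {φ : ℝ → E2} {lam M : ℝ} {b : ℕ}

lemma term_bound (hM : ∀ x, ‖φ x‖ ≤ M) (hl0 : 0 < lam) (m : ℕ) (x : ℝ) :
    ‖lam ^ m • φ ((b : ℝ) ^ m * x)‖ ≤ M * lam ^ m := by
  rw [norm_smul, Real.norm_eq_abs, abs_of_pos (by positivity), mul_comm]
  gcongr
  exact hM _

lemma W_summable (hM : ∀ x, ‖φ x‖ ≤ M) (hl0 : 0 < lam) (hl1 : lam < 1) (x : ℝ) :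
    Summable (fun m : ℕ => lam ^ m • φ ((b : ℝ) ^ m * x)) :=
  Summable.of_norm_bounded ((summable_geometric_of_lt_one hl0.le hl1).mul_left M)
    (fun m => term_bound hM hl0 m x)

lemma W_tail (hM : ∀ x, ‖φ x‖ ≤ M) (hl0 : 0 < lam) (hl1 : lam < 1) (n : ℕ) (x : ℝ) :
    ‖(∑' m : ℕ, lam ^ m • φ ((b : ℝ) ^ m * x)) - SS φ lam b n x‖ ≤ lam ^ n * (M / (1 - lam)) := by
  have h := (W_summable (b := b) hM hl0 hl1 x).sum_add_tsum_nat_add n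
  have h2 : (∑' m : ℕ, lam ^ m • φ ((b : ℝ) ^ m * x)) - SS φ lam b n x
      = ∑' m : ℕ, lam ^ (m + n) • φ ((b : ℝ) ^ (m + n) * x) := by
    rw [← h, SS]; abel
  rw [h2]
  have hs : HasSum (fun m : ℕ => (M * lam ^ n) * lam ^ m) ((M * lam ^ n) * (1 - lam)⁻¹) :=
    (hasSum_geometric_of_lt_one hl0.le hl1).mul_left _
  refine (tsum_of_norm_bounded hs (fun m => ?_)).trans (le_of_eq (by rw [div_eq_mul_inv]; ring))
  refine (term_bound hM hl0 (m + n) x).trans (le_of_eq (by rw [pow_add]; ring))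

lemma W_cont (hφ : Continuous φ) (hM : ∀ x, ‖φ x‖ ≤ M) (hl0 : 0 < lam) (hl1 : lam < 1) :
    Continuous (fun x => ∑' m : ℕ, lam ^ m • φ ((b : ℝ) ^ m * x)) :=
  continuous_tsum (fun m => by fun_prop)
    ((summable_geometric_of_lt_one hl0.le hl1).mul_left M) (fun m x => term_bound hM hl0 m x)
end

lemma iter_ball {φ : ℝ → E2} (hper : Function.Periodic φ 1) {K M : ℝ} (hK : 0 ≤ K)
    (hM : ∀ x, ‖φ x‖ ≤ M)
    (hLip : ∀ x y, ‖φ x - φ y‖ ≤ K * |x - y|) (hφ : Continuous φ) {U : Set E2}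
    (hU : IsOpen U) (hb : Bornology.IsBounded U) (hfr : frontier U ⊆ range φ)
    (hdisj : Disjoint U (range φ)) {κ lam e : ℝ} (hκ : 0 < κ) (hball : ball 0 κ ⊆ U)
    (hl0 : 0 < lam) (hl1 : lam < 1) (he : 8 * e < κ * lam)
    {b : ℕ} (hq : 2 ≤ lam * b) (heK : 2 * K / (lam * b) ≤ e)
    {z : E2} (hz : z ∈ frontier (VV (range φ) U (κ * lam / 4))) (N j : ℕ) (y : E2)
    (hy : ‖(lam ^ N)⁻¹ • (y - SS φ lam b N (j / (b : ℝ) ^ N)) - z‖ ≤ e) :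
    ∃ x ∈ Icc ((j : ℝ) / (b : ℝ) ^ N) (((j : ℝ) + 1) / (b : ℝ) ^ N),
      ∑' m : ℕ, lam ^ m • φ ((b : ℝ) ^ m * x) = y := by
  have hb0 : (0 : ℝ) < b := by
    by_contra h
    push Not at h
    nlinarith
  have hb1 : 1 ≤ b := by exact_mod_cast hb0
  have he0 : 0 ≤ e := le_trans (by positivity) heK
  have hS : range φ = φ '' Icc 0 1 := by
    have := hper.image_Icc one_pos 0
    rw [zero_add] at this
    exact this.symm
  set V := VV (range φ) U (κ * lam / 4) with hVdef
  have main : ∀ k : ℕ, ∃ j' : ℕ, Icc ((j' : ℝ) / (b : ℝ) ^ (N + k)) (((j' : ℝ) + 1) / (b : ℝ) ^ (N + k))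
      ⊆ Icc ((j : ℝ) / (b : ℝ) ^ N) (((j : ℝ) + 1) / (b : ℝ) ^ N) ∧
      ∃ x ∈ Icc ((j' : ℝ) / (b : ℝ) ^ (N + k)) (((j' : ℝ) + 1) / (b : ℝ) ^ (N + k)),
      ∃ z ∈ frontier V, ‖(lam ^ (N + k))⁻¹ • (y - SS φ lam b (N + k) x) - z‖ ≤ e := by
    intro k
    induction k with
    | zero =>
      refine ⟨j, Subset.rfl, j / (b : ℝ) ^ N, ⟨le_rfl, ?_⟩, z, hz, hy⟩
      show (j : ℝ) / (b : ℝ) ^ N ≤ (j + 1) / (b : ℝ) ^ N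
      gcongr
      simp
    | succ k ih =>
      obtain ⟨j', hsub, x0, hx0, z', hz', hx0z⟩ := ih
      set n := N + k with hn
      have hbn : (0 : ℝ) < (b : ℝ) ^ n := by positivity
      set g : ℝ → E2 := fun t => (lam ^ n)⁻¹ • (y - SS φ lam b n ((j' + t) / (b : ℝ) ^ n)) with hg
      have hgc : Continuous g := by
        have := SS_cont hφ lam b n
        fun_prop
      have hgz : ∀ t ∈ Icc (0 : ℝ) 1, ‖g t - z'‖ ≤ 2 * e := by
        intro t ht
        have h1 : g t - z' = ((lam ^ n)⁻¹ • (y - SS φ lam b n x0) - z') +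
            (lam ^ n)⁻¹ • (SS φ lam b n x0 - SS φ lam b n ((j' + t) / (b : ℝ) ^ n)) := by
          simp only [hg, smul_sub]; abel
        rw [h1]
        refine (norm_add_le _ _).trans ?_
        have h2 : ‖(lam ^ n)⁻¹ • (SS φ lam b n x0 - SS φ lam b n ((j' + t) / (b : ℝ) ^ n))‖ ≤ e := by
          rw [norm_smul, norm_inv, Real.norm_eq_abs, abs_of_pos (by positivity),
            inv_mul_le_iff₀ (by positivity)]
          refine (SS_lip hK hLip hl0 hq n _ _).trans ?_
          have h3 : |x0 - (j' + t) / (b : ℝ) ^ n| ≤ 1 / (b : ℝ) ^ n := by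
            have h4 : (j' : ℝ) / (b : ℝ) ^ n ≤ (j' + t) / (b : ℝ) ^ n := by
              gcongr; linarith [ht.1]
            have h5 : (j' + t) / (b : ℝ) ^ n ≤ (j' + 1 : ℝ) / (b : ℝ) ^ n := by
              gcongr; exact ht.2
            have h6 : (j' + 1 : ℝ) / (b : ℝ) ^ n = j' / (b : ℝ) ^ n + 1 / (b : ℝ) ^ n := by ring
            rw [abs_le]
            constructor <;> linarith [hx0.1, hx0.2]
          calc 2 * K / (lam * b) * (lam * b) ^ n * |x0 - (j' + t) / (b : ℝ) ^ n|
              ≤ e * (lam * b) ^ n * (1 / (b : ℝ) ^ n) := by gcongr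
            _ = lam ^ n * e := by rw [mul_pow]; field_simp
        linarith
      obtain ⟨t, ht, hfrt⟩ := step hφ hS hU hb hfr hdisj hκ hball hl0 hl1 he hz' hgc hgz
      obtain ⟨i, hib, hi1, hi2⟩ := exists_digit hb1 ht
      have hib' : (i : ℝ) + 1 ≤ b := by exact_mod_cast hib
      have hpow : (b : ℝ) ^ (N + (k + 1)) = b * (b : ℝ) ^ n := by
        rw [hn]; ring
      refine ⟨b * j' + i, ?_, (j' + t) / (b : ℝ) ^ n, ⟨?_, ?_⟩, _, hfrt, ?_⟩
      · refine Subset.trans ?_ hsub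
        rw [hpow]
        apply Icc_subset_Icc
        · rw [div_le_div_iff₀ hbn (by positivity)]
          push_cast
          nlinarith [mul_nonneg (Nat.cast_nonneg i : (0 : ℝ) ≤ i) hbn.le]
        · rw [div_le_div_iff₀ (by positivity) hbn]
          push_cast
          nlinarith [mul_le_mul_of_nonneg_right hib' hbn.le]
      · rw [hpow, div_le_div_iff₀ (by positivity) hbn]
        push_cast
        nlinarith [mul_le_mul_of_nonneg_right hi1 hbn.le]
      · rw [hpow, div_le_div_iff₀ hbn (by positivity)]
        push_cast
        nlinarith [mul_le_mul_of_nonneg_right hi2 hbn.le]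
      · have hφt : φ ((b : ℝ) ^ n * ((j' + t) / (b : ℝ) ^ n)) = φ t := by
          rw [mul_div_cancel₀ _ hbn.ne', add_comm]
          have := hper.nat_mul j' t
          simpa using this
        have : (lam ^ (N + (k + 1)))⁻¹ • (y - SS φ lam b (N + (k + 1)) ((j' + t) / (b : ℝ) ^ n))
            = lam⁻¹ • (g t - φ t) := by
          have hN : N + (k + 1) = n + 1 := by rw [hn]; ring
          have hln : lam ^ n ≠ 0 := by positivity
          rw [hN, hg]
          simp only [SS, Finset.sum_range_succ, hφt, pow_succ]
          rw [mul_inv, mul_comm, mul_smul, ← sub_sub, smul_sub (lam ^ n)⁻¹ _ (lam ^ n • φ t),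
            smul_smul, inv_mul_cancel₀ hln, one_smul]
        rw [this, sub_self, norm_zero]
        exact le_trans (by positivity) heK
  set W : ℝ → E2 := fun x => ∑' m : ℕ, lam ^ m • φ ((b : ℝ) ^ m * x) with hW
  have hWc : Continuous W := W_cont hφ hM hl0 hl1
  set I := Icc ((j : ℝ) / (b : ℝ) ^ N) (((j : ℝ) + 1) / (b : ℝ) ^ N)
  have hcl : IsClosed (W '' I) := (isCompact_Icc.image hWc).isClosed
  suffices y ∈ W '' I by
    obtain ⟨x, hx, hxy⟩ := this
    exact ⟨x, hx, hxy⟩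
  rw [← hcl.closure_eq, Metric.mem_closure_iff]
  intro δ hδ
  have hVb : Bornology.IsBounded (closure V) := (hb.subset inter_subset_left).closure
  obtain ⟨R, hR⟩ := hVb.exists_norm_le
  have hlim : Tendsto (fun k : ℕ => lam ^ (N + k) * (e + R + M / (1 - lam))) atTop (𝓝 0) := by
    have h1 : Tendsto (fun k : ℕ => lam ^ k) atTop (𝓝 0) :=
      tendsto_pow_atTop_nhds_zero_of_lt_one hl0.le hl1
    have h2 := (h1.const_mul (lam ^ N)).mul_const (e + R + M / (1 - lam))
    simpa [pow_add] using h2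
  obtain ⟨k, hk⟩ := (hlim.eventually (gt_mem_nhds hδ)).exists
  obtain ⟨j', hsub, x, hx, z', hz', hxz⟩ := main k
  refine ⟨W x, ⟨x, hsub hx, rfl⟩, ?_⟩
  have h1 := W_tail (b := b) hM hl0 hl1 (N + k) x
  have h2 : ‖(lam ^ (N + k))⁻¹ • (y - SS φ lam b (N + k) x)‖ ≤ e + R := by
    have := norm_le_norm_add_norm_sub z' ((lam ^ (N + k))⁻¹ • (y - SS φ lam b (N + k) x))
    rw [norm_sub_rev] at this
    have := hR z' (frontier_subset_closure hz')
    linarith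
  rw [norm_smul, norm_inv, Real.norm_eq_abs, abs_of_pos (by positivity),
            inv_mul_le_iff₀ (by positivity)] at h2
  rw [dist_eq_norm]
  have h3 : y - W x = (y - SS φ lam b (N + k) x) - (W x - SS φ lam b (N + k) x) := by abel
  rw [h3]
  refine lt_of_le_of_lt (norm_sub_le _ _) ?_
  simp only [hW]
  linarith

lemma has_balls (φ : ℝ → E2) (hper : ∀ x : ℝ, φ (x + 1) = φ x)
    {K : ℝ} (hK : 0 ≤ K) (hLip : ∀ x y, ‖φ x - φ y‖ ≤ K * |x - y|) (hφ : Continuous φ)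
    (hdisc : ¬ IsConnected ((Set.range φ)ᶜ)) :
    ∃ c : ℝ, 2 ≤ c ∧ ∀ (b : ℕ), ∀ lam : ℝ, 0 < lam → lam < 1 →
      (b : ℝ) * lam ^ 2 > c → ∃ ρ : ℝ, 0 < ρ ∧ ∀ N j : ℕ, ∃ C : E2, ∀ y : E2,
        ‖y - C‖ ≤ ρ * lam ^ N →
        ∃ x ∈ Icc ((j : ℝ) / (b : ℝ) ^ N) (((j : ℝ) + 1) / (b : ℝ) ^ N),
          ∑' m : ℕ, lam ^ m • φ ((b : ℝ) ^ m * x) = y := by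
  have hper' : Function.Periodic φ 1 := hper
  have hS : range φ = φ '' Icc 0 1 := by
    have := hper'.image_Icc one_pos 0
    rw [zero_add] at this
    exact this.symm
  have hcomp : IsCompact (range φ) := by rw [hS]; exact isCompact_Icc.image hφ
  obtain ⟨U, hU, ⟨a, ha⟩, hb, hdisj, hfr⟩ := exists_U _ hcomp hdisc
  obtain ⟨κ, hκ, hball⟩ := Metric.isOpen_iff.mp hU a ha
  set ψ : ℝ → E2 := fun x => φ x - a with hψ
  set τ : E2 ≃ₜ E2 := Homeomorph.addRight (-a) with hτ
  have hrange : range ψ = τ '' range φ := by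
    rw [← range_comp]; congr 1
  have hψb : ∃ M, ∀ x, ‖ψ x‖ ≤ M := by
    obtain ⟨M, hM⟩ := hcomp.isBounded.exists_norm_le
    refine ⟨M + ‖a‖, fun x => (norm_sub_le _ _).trans ?_⟩
    have := hM _ (mem_range_self x)
    linarith
  obtain ⟨M, hM⟩ := hψb
  have hψper : Function.Periodic ψ 1 := fun x => by simp only [hψ, hper]
  have hψLip : ∀ x y, ‖ψ x - ψ y‖ ≤ K * |x - y| := fun x y => by
    simpa [hψ] using hLip x y
  have hψc : Continuous ψ := by fun_prop
  have hU' : IsOpen (τ '' U) := τ.isOpenMap _ hU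
  have hb' : Bornology.IsBounded (τ '' U) := by
    have hc : IsCompact (closure U) := hb.isCompact_closure
    exact (hc.image τ.continuous).isBounded.subset (image_mono subset_closure)
  have hfr' : frontier (τ '' U) ⊆ range ψ := by
    rw [← τ.image_frontier, hrange]; exact image_mono hfr
  have hdisj' : Disjoint (τ '' U) (range ψ) := by
    rw [hrange]; exact (Set.disjoint_image_iff τ.injective).mpr hdisj
  have hball' : ball 0 κ ⊆ τ '' U := by
    intro x hx
    refine ⟨x + a, hball ?_, by simp [hτ]⟩
    rw [mem_ball, dist_eq_norm, add_sub_cancel_right]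
    simpa using hx
  refine ⟨32 * K / κ + 2, by have : 0 ≤ 32 * K / κ := by positivity
                             linarith, ?_⟩
  intro b lam hl0 hl1 hc
  have hc1 : 2 < b * lam ^ 2 := by
    have : 0 ≤ 32 * K / κ := by positivity
    linarith
  have hc2 : 32 * K ≤ κ * (b * lam ^ 2) := by
    have h1 : 32 * K / κ ≤ b * lam ^ 2 := by linarith
    rw [div_le_iff₀ hκ] at h1
    linarith
  have hq : 2 ≤ lam * b := by
    have h1 : lam * (lam * b) ≤ 1 * (lam * b) := by
      apply mul_le_mul_of_nonneg_right hl1.le; positivity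
    nlinarith
  set e := κ * lam / 16 with he
  have hκl : 0 < κ * lam := by positivity
  have heK : 2 * K / (lam * b) ≤ e := by
    rw [div_le_iff₀ (by linarith), he]
    nlinarith
  have hVne : (frontier (VV (range ψ) (τ '' U) (κ * lam / 4))).Nonempty := by
    rw [nonempty_frontier_iff]
    constructor
    · refine ⟨0, hball' (by simpa using hκ), ?_⟩
      show κ * lam / 4 < infDist 0 (range ψ)
      have : κ ≤ infDist (0 : E2) (range ψ) := by
        rw [le_infDist (range_nonempty ψ)]
        intro p hp
        by_contra h
        push Not at h
        exact Set.disjoint_left.mp hdisj' (hball' (by rwa [mem_ball, dist_comm])) hp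
      nlinarith
    · intro h
      have hbu : Bornology.IsBounded (univ : Set E2) := by
        rw [← h]; exact hb'.subset inter_subset_left
      obtain ⟨R, hR⟩ := hbu.exists_norm_le
      obtain ⟨x, hx⟩ := NormedSpace.exists_lt_norm ℝ E2 R
      exact absurd (hR x (mem_univ x)) (not_le.mpr hx)
  obtain ⟨z, hz⟩ := hVne
  refine ⟨e, by positivity, fun N j => ?_⟩
  refine ⟨SS ψ lam b N (j / (b : ℝ) ^ N) + lam ^ N • z + (1 - lam)⁻¹ • a, fun y hy => ?_⟩
  obtain ⟨x, hx, hxy⟩ := iter_ball hψper hK hM hψLip hψc hU' hb' hfr' hdisj' hκ hball' hl0 hl1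
    (by rw [he]; linarith) hq heK hz N j (y - (1 - lam)⁻¹ • a) (by
      have hln : (0 : ℝ) < lam ^ N := by positivity
      have : (lam ^ N)⁻¹ • (y - (1 - lam)⁻¹ • a - SS ψ lam b N (j / (b : ℝ) ^ N)) - z
          = (lam ^ N)⁻¹ • (y - (SS ψ lam b N (j / (b : ℝ) ^ N) + lam ^ N • z + (1 - lam)⁻¹ • a)) := by
        have h1 : z = (lam ^ N)⁻¹ • (lam ^ N • z) := by
          rw [smul_smul, inv_mul_cancel₀ hln.ne', one_smul]
        nth_rewrite 1 [h1]
        rw [← smul_sub]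
        congr 1
        abel
      rw [this, norm_smul, norm_inv, Real.norm_eq_abs, abs_of_pos hln, inv_mul_le_iff₀ hln]
      linarith)
  refine ⟨x, hx, ?_⟩
  have hsum : HasSum (fun m : ℕ => lam ^ m • φ ((b : ℝ) ^ m * x))
      ((y - (1 - lam)⁻¹ • a) + (1 - lam)⁻¹ • a) := by
    have h1 := (W_summable (b := b) hM hl0 hl1 x).hasSum
    rw [hxy] at h1
    have h2 := (hasSum_geometric_of_lt_one hl0.le hl1).smul_const a
    have h3 := h1.add h2
    refine h3.congr_fun ?_ 
    intro m
    simp [hψ, smul_sub]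
  rw [hsum.tsum_eq]
  abel

/-- The graph. -/
def GG (W : ℝ → E2) : Set (Fin 3 → ℝ) :=
  {p : Fin 3 → ℝ | ∃ x ∈ Set.Icc (0 : ℝ) 1, p = ![x, W x 0, W x 1]}

/-- The set of boxes. -/
def BB (b n : ℕ) (A : Set (Fin 3 → ℝ)) : Set (Fin 3 → ℤ) :=
  {k : Fin 3 → ℤ | ∃ p ∈ A, ∀ i : Fin 3,
    (k i : ℝ) / (b : ℝ) ^ n ≤ p i ∧ p i < ((k i : ℝ) + 1) / (b : ℝ) ^ n}

lemma mem_BB {b n : ℕ} (hb : 0 < b) {W : ℝ → E2} {k : Fin 3 → ℤ} :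
    k ∈ BB b n (GG W) ↔ ∃ x ∈ Icc (0 : ℝ) 1, k 0 = ⌊(b : ℝ) ^ n * x⌋ ∧
      k 1 = ⌊(b : ℝ) ^ n * W x 0⌋ ∧ k 2 = ⌊(b : ℝ) ^ n * W x 1⌋ := by
  have hbn : (0 : ℝ) < (b : ℝ) ^ n := by positivity
  have key : ∀ (k : ℤ) (p : ℝ), ((k : ℝ) / (b : ℝ) ^ n ≤ p ∧ p < ((k : ℝ) + 1) / (b : ℝ) ^ n) ↔
      k = ⌊(b : ℝ) ^ n * p⌋ := by
    intro k p
    rw [eq_comm, Int.floor_eq_iff, div_le_iff₀ hbn, lt_div_iff₀ hbn, mul_comm p]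
  constructor
  · rintro ⟨p, ⟨x, hx, rfl⟩, h⟩
    refine ⟨x, hx, (key _ _).mp ?_, (key _ _).mp ?_, (key _ _).mp ?_⟩
    · simpa using h 0
    · simpa using h 1
    · simpa using h 2
  · rintro ⟨x, hx, h0, h1, h2⟩
    refine ⟨_, ⟨x, hx, rfl⟩, fun i => ?_⟩
    fin_cases i
    · simpa using (key _ _).mpr h0
    · simpa using (key _ _).mpr h1
    · simpa using (key _ _).mpr h2

lemma floor_close {u v D : ℝ} (h : |u - v| ≤ D) :
    ⌊u⌋ - ⌊v⌋ ∈ Icc (-((⌈D⌉₊ : ℤ) + 1)) ((⌈D⌉₊ : ℤ) + 1) := by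
  have h1 := Int.floor_le u
  have h2 := Int.lt_floor_add_one u
  have h3 := Int.floor_le v
  have h4 := Int.lt_floor_add_one v
  have h5 := Nat.le_ceil D
  rw [abs_le] at h
  constructor
  · have : (-((⌈D⌉₊ : ℝ) + 1)) ≤ (⌊u⌋ : ℝ) - ⌊v⌋ := by linarith
    exact_mod_cast this
  · have : (⌊u⌋ : ℝ) - ⌊v⌋ ≤ ((⌈D⌉₊ : ℝ) + 1) := by linarith
    exact_mod_cast this

lemma count_upper {b : ℕ} (hb : 0 < b) {W : ℝ → E2} {C lam : ℝ} (hC : 0 ≤ C) (hl0 : 0 < lam)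
    (hq : 1 ≤ lam * b)
    (hosc : ∀ (N : ℕ) (x y : ℝ), |x - y| ≤ 1 / (b : ℝ) ^ N → ‖W x - W y‖ ≤ C * lam ^ N) (N : ℕ) :
    (BB b N (GG W)).Finite ∧
      ((BB b N (GG W)).ncard : ℝ) ≤ 2 * (2 * C + 5) ^ 2 * ((b : ℝ) ^ 3 * lam ^ 2) ^ N := by
  have hbn : (0 : ℝ) < (b : ℝ) ^ N := by positivity
  set D := C * (lam * b) ^ N with hD
  have hD0 : 0 ≤ D := by positivity
  set L : ℤ := (⌈D⌉₊ : ℤ) + 1 with hL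
  set f : (Fin 3 → ℤ) → ℤ × ℤ × ℤ := fun k =>
    (k 0, k 1 - ⌊(b : ℝ) ^ N * W (k 0 / (b : ℝ) ^ N) 0⌋,
      k 2 - ⌊(b : ℝ) ^ N * W (k 0 / (b : ℝ) ^ N) 1⌋) with hf
  set T : Finset (ℤ × ℤ × ℤ) :=
    Finset.Icc (0 : ℤ) ((b ^ N : ℕ) : ℤ) ×ˢ (Finset.Icc (-L) L ×ˢ Finset.Icc (-L) L) with hT
  have hmaps : ∀ k ∈ BB b N (GG W), f k ∈ (T : Set (ℤ × ℤ × ℤ)) := by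
    intro k hk
    rw [mem_BB hb] at hk
    obtain ⟨x, hx, h0, h1, h2⟩ := hk
    have hclose : ‖W x - W (k 0 / (b : ℝ) ^ N)‖ ≤ C * lam ^ N := by
      apply hosc
      rw [h0]
      have e1 := Int.floor_le ((b : ℝ) ^ N * x)
      have e2 := Int.lt_floor_add_one ((b : ℝ) ^ N * x)
      have e3 : x - (⌊(b : ℝ) ^ N * x⌋ : ℝ) / (b : ℝ) ^ N
          = ((b : ℝ) ^ N * x - ⌊(b : ℝ) ^ N * x⌋) / (b : ℝ) ^ N := by
        field_simp
      rw [e3, abs_div, abs_of_pos hbn]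
      gcongr
      rw [abs_le]; constructor <;> linarith
    have hcoord : ∀ i : Fin 2, |(b : ℝ) ^ N * W x i - (b : ℝ) ^ N * W (k 0 / (b : ℝ) ^ N) i| ≤ D := by
      intro i
      have := (PiLp.norm_apply_le (W x - W (k 0 / (b : ℝ) ^ N)) i).trans hclose
      rw [PiLp.sub_apply, Real.norm_eq_abs] at this
      rw [← mul_sub, abs_mul, abs_of_pos hbn]
      calc (b : ℝ) ^ N * _ ≤ (b : ℝ) ^ N * (C * lam ^ N) := by gcongr
        _ = D := by rw [hD, mul_pow]; ring
    simp only [hT, hf, Finset.coe_product, mem_prod, Finset.coe_Icc]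
    refine ⟨⟨?_, ?_⟩, ?_, ?_⟩
    · rw [h0]; exact Int.floor_nonneg.mpr (mul_nonneg hbn.le hx.1)
    · rw [h0, Int.floor_le_iff]
      push_cast
      nlinarith [hx.2]
    · rw [h1]; exact floor_close (hcoord 0)
    · rw [h2]; exact floor_close (hcoord 1)
  have hinj : InjOn f (BB b N (GG W)) := by
    intro k _ k' _ h
    simp only [hf, Prod.mk.injEq] at h
    obtain ⟨h0, h1, h2⟩ := h
    rw [h0] at h1 h2
    ext i
    fin_cases i
    · exact h0
    · exact sub_left_injective h1
    · exact sub_left_injective h2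
  have hfin : (BB b N (GG W)).Finite := Set.Finite.of_injOn hmaps hinj T.finite_toSet
  refine ⟨hfin, ?_⟩
  have hle := Set.ncard_le_ncard_of_injOn f hmaps hinj T.finite_toSet
  rw [Set.ncard_coe_finset, hT, Finset.card_product, Finset.card_product, Int.card_Icc,
    Int.card_Icc] at hle
  have hle' : ((BB b N (GG W)).ncard : ℝ) ≤ ((b : ℝ) ^ N + 1) * ((2 * (⌈D⌉₊ : ℝ) + 3) * (2 * (⌈D⌉₊ : ℝ) + 3)) := by
    have e1 : (((b ^ N : ℕ) : ℤ) + 1 - 0).toNat = b ^ N + 1 := by omega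
    have e2 : (L + 1 - -L).toNat = 2 * ⌈D⌉₊ + 3 := by omega
    rw [e1, e2] at hle
    exact_mod_cast hle
  refine hle'.trans ?_
  have hq1 : 1 ≤ (lam * b) ^ N := one_le_pow₀ hq
  have hb1 : (1 : ℝ) ≤ (b : ℝ) ^ N := one_le_pow₀ (by exact_mod_cast hb)
  have hceil := Nat.ceil_lt_add_one hD0
  have e3 : 2 * (⌈D⌉₊ : ℝ) + 3 ≤ (2 * C + 5) * (lam * b) ^ N := by
    rw [hD] at hceil ⊢
    linarith
  calc ((b : ℝ) ^ N + 1) * ((2 * (⌈D⌉₊ : ℝ) + 3) * (2 * (⌈D⌉₊ : ℝ) + 3))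
      ≤ (2 * (b : ℝ) ^ N) * (((2 * C + 5) * (lam * b) ^ N) * ((2 * C + 5) * (lam * b) ^ N)) := by
        gcongr; linarith
    _ = _ := by rw [mul_pow, mul_pow, ← pow_mul, ← pow_mul]; ring

lemma norm_le_coords (v : E2) {r : ℝ} (h0 : |v 0| ≤ r) (h1 : |v 1| ≤ r) : ‖v‖ ≤ 2 * r := by
  have hr : 0 ≤ r := (abs_nonneg _).trans h0
  rw [EuclideanSpace.norm_eq, Real.sqrt_le_left (by linarith)]
  simp only [Fin.sum_univ_two, Real.norm_eq_abs]
  nlinarith [abs_nonneg (v 0), abs_nonneg (v 1)]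

lemma count_lower {b : ℕ} (hb : 2 ≤ b) {W : ℝ → E2} {ρ lam : ℝ} (hρ : 0 < ρ) (hl0 : 0 < lam)
    (hballs : ∀ N j : ℕ, ∃ C : E2, ∀ y : E2, ‖y - C‖ ≤ ρ * lam ^ N →
        ∃ x ∈ Icc ((j : ℝ) / (b : ℝ) ^ N) (((j : ℝ) + 1) / (b : ℝ) ^ N), W x = y)
    (N : ℕ) (hN : 1 ≤ N) (hfin : (BB b N (GG W)).Finite) (hbig : 8 ≤ ρ * (lam * b) ^ N) :
    ρ ^ 2 / 64 * ((b : ℝ) ^ 3 * lam ^ 2) ^ N ≤ ((BB b N (GG W)).ncard : ℝ) := by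
  have hb0 : 0 < b := by omega
  have hbn : (0 : ℝ) < (b : ℝ) ^ N := by positivity
  choose C hC using hballs
  set q := ρ * (lam * b) ^ N / 2 with hq
  set B := ⌊q⌋₊ - 1 with hB
  have hq4 : 4 ≤ q := by rw [hq]; linarith
  have hBq : (B : ℝ) + 1 ≤ q := by
    have h1 : B + 1 = ⌊q⌋₊ := by
      have : 4 ≤ ⌊q⌋₊ := Nat.le_floor (by exact_mod_cast hq4)
      omega
    have h2 : ((B : ℝ) + 1) = (⌊q⌋₊ : ℝ) := by exact_mod_cast h1
    rw [h2]; exact Nat.floor_le (by linarith)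
  have hBq' : q / 2 ≤ B := by
    have h1 : B + 1 = ⌊q⌋₊ := by
      have : 4 ≤ ⌊q⌋₊ := Nat.le_floor (by exact_mod_cast hq4)
      omega
    have h2 : ((B : ℝ) + 1) = (⌊q⌋₊ : ℝ) := by exact_mod_cast h1
    have := Nat.lt_floor_add_one q
    linarith
  set A := b ^ N / 2 with hA
  have hAb : (b : ℝ) ^ N / 4 ≤ A := by
    have h1 : 2 ≤ b ^ N := by
      calc 2 ≤ b := hb
        _ = b ^ 1 := (pow_one b).symm
        _ ≤ b ^ N := Nat.pow_le_pow_right hb0 hN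
    have h2 : b ^ N ≤ 4 * A := by omega
    have : ((b : ℝ) ^ N) ≤ 4 * A := by exact_mod_cast h2
    linarith
  have hpt : ∀ p : Fin A × Fin B × Fin B, ∃ k ∈ BB b N (GG W), k 0 / 2 = (p.1 : ℤ) ∧
      k 1 = ⌈(b : ℝ) ^ N * C N (2 * p.1) 0⌉ + (p.2.1 : ℤ) ∧
      k 2 = ⌈(b : ℝ) ^ N * C N (2 * p.1) 1⌉ + (p.2.2 : ℤ) := by
    rintro ⟨i, u, v⟩
    set c := C N (2 * i) with hc
    set k1 : ℤ := ⌈(b : ℝ) ^ N * c 0⌉ + (u : ℤ) with hk1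
    set k2 : ℤ := ⌈(b : ℝ) ^ N * c 1⌉ + (v : ℤ) with hk2
    set y : E2 := !₂[(k1 : ℝ) / (b : ℝ) ^ N, (k2 : ℝ) / (b : ℝ) ^ N] with hy
    have hco : ∀ (s : ℝ) (w : Fin B), |((⌈(b : ℝ) ^ N * s⌉ + (w : ℤ) : ℤ) : ℝ) / (b : ℝ) ^ N - s|
        ≤ q / (b : ℝ) ^ N := by
      intro s w
      have e1 := Int.le_ceil ((b : ℝ) ^ N * s)
      have e2 := Int.ceil_lt_add_one ((b : ℝ) ^ N * s)
      have e3 : ((w : ℕ) : ℝ) ≤ B := by exact_mod_cast w.2.le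
      have e4 : (0 : ℝ) ≤ ((w : ℕ) : ℝ) := Nat.cast_nonneg _
      have e5 : ((⌈(b : ℝ) ^ N * s⌉ + (w : ℤ) : ℤ) : ℝ) / (b : ℝ) ^ N - s
          = ((⌈(b : ℝ) ^ N * s⌉ : ℝ) + ((w : ℕ) : ℝ) - (b : ℝ) ^ N * s) / (b : ℝ) ^ N := by
        push_cast; field_simp
      rw [e5, abs_div, abs_of_pos hbn]
      gcongr
      rw [abs_le]; constructor <;> linarith
    obtain ⟨x, hx, hxy⟩ := hC N (2 * i) y (by
      refine (norm_le_coords _ (r := q / (b : ℝ) ^ N) ?_ ?_).trans (le_of_eq ?_)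
      · simp only [hy, PiLp.sub_apply]; exact hco (c 0) u
      · simp only [hy, PiLp.sub_apply]; exact hco (c 1) v
      · rw [hq, mul_pow]; field_simp)
    have hi : 2 * (i : ℕ) + 1 ≤ b ^ N := by have := i.2; omega
    have hi' : 2 * ((i : ℕ) : ℝ) + 1 ≤ (b : ℝ) ^ N := by exact_mod_cast hi
    have hx1 := hx.1
    have hx2 := hx.2
    push_cast at hx1 hx2
    have hx1' := (div_le_iff₀' hbn).mp hx1
    have hx2' := (le_div_iff₀' hbn).mp hx2
    refine ⟨![⌊(b : ℝ) ^ N * x⌋, k1, k2], ?_, ?_, rfl, rfl⟩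
    · rw [mem_BB hb0]
      refine ⟨x, ⟨?_, ?_⟩, rfl, ?_, ?_⟩
      · exact le_trans (by positivity) hx1
      · exact hx2.trans ((div_le_one hbn).mpr hi')
      · rw [hxy]; simp [hy, mul_div_cancel₀ _ hbn.ne']
      · rw [hxy]; simp [hy, mul_div_cancel₀ _ hbn.ne']
    · show ⌊(b : ℝ) ^ N * x⌋ / 2 = ((i : ℕ) : ℤ)
      have e1 : (2 * ((i : ℕ) : ℤ)) ≤ ⌊(b : ℝ) ^ N * x⌋ := by
        rw [Int.le_floor]; push_cast; exact hx1'
      have e2 : ⌊(b : ℝ) ^ N * x⌋ < 2 * ((i : ℕ) : ℤ) + 2 := by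
        rw [Int.floor_lt]; push_cast; linarith
      omega
  choose F hF h0 h1 h2 using hpt
  have hFinj : Function.Injective F := by
    rintro ⟨i, u, v⟩ ⟨i', u', v'⟩ h
    have a0 := h0 ⟨i, u, v⟩
    have a1 := h1 ⟨i, u, v⟩
    have a2 := h2 ⟨i, u, v⟩
    rw [h, h0] at a0
    have hii : i' = i := by
      apply Fin.ext; exact_mod_cast a0
    subst hii
    rw [h, h1] at a1
    rw [h, h2] at a2
    simp only [add_right_inj] at a1 a2
    have : u' = u := by apply Fin.ext; exact_mod_cast a1
    have : v' = v := by apply Fin.ext; exact_mod_cast a2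
    subst_vars
    rfl
  have hle := Set.ncard_le_ncard_of_injOn (s := (univ : Set (Fin A × Fin B × Fin B))) F
    (fun p _ => hF p) hFinj.injOn hfin
  rw [Set.ncard_univ, Nat.card_eq_fintype_card] at hle
  simp only [Fintype.card_prod, Fintype.card_fin] at hle
  have hle' : (A : ℝ) * (B * B) ≤ ((BB b N (GG W)).ncard : ℝ) := by exact_mod_cast hle
  refine le_trans ?_ hle'
  calc ρ ^ 2 / 64 * ((b : ℝ) ^ 3 * lam ^ 2) ^ N = ((b : ℝ) ^ N / 4) * ((q / 2) * (q / 2)) := by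
        rw [hq, mul_pow, mul_pow, ← pow_mul, ← pow_mul]; ring
    _ ≤ _ := by gcongr

lemma limit_dim {b : ℕ} (hb : 2 ≤ b) {lam : ℝ} (hl0 : 0 < lam) (f : ℕ → ℕ) {A₁ A₂ : ℝ}
    (hA : 0 < A₁) (h1 : ∀ᶠ N in atTop, A₁ * ((b : ℝ) ^ 3 * lam ^ 2) ^ N ≤ f N)
    (h2 : ∀ᶠ N in atTop, (f N : ℝ) ≤ A₂ * ((b : ℝ) ^ 3 * lam ^ 2) ^ N) :
    Tendsto (fun n : ℕ => Real.log (f n) / (n * Real.log b)) atTop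
      (𝓝 (3 + 2 * Real.logb b lam)) := by
  have hb0 : (0 : ℝ) < b := by positivity
  have hlb : 0 < Real.log b := Real.log_pos (by exact_mod_cast hb)
  set Q := (b : ℝ) ^ 3 * lam ^ 2 with hQ
  have hQ0 : 0 < Q := by positivity
  have hlQ : Real.log Q / Real.log b = 3 + 2 * Real.logb b lam := by
    rw [hQ, Real.log_mul (by positivity) (by positivity), Real.log_pow, Real.log_pow, Real.logb]
    push_cast; field_simp
  have hlim : ∀ A : ℝ, Tendsto (fun n : ℕ => Real.log A / (n * Real.log b) + Real.log Q / Real.log b)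
      atTop (𝓝 (3 + 2 * Real.logb b lam)) := by
    intro A
    rw [← hlQ]
    have : Tendsto (fun n : ℕ => Real.log A / (n * Real.log b)) atTop (𝓝 0) :=
      tendsto_const_nhds.div_atTop (tendsto_natCast_atTop_atTop.atTop_mul_const hlb)
    simpa using this.add_const (Real.log Q / Real.log b)
  have hexp : ∀ (A : ℝ) (n : ℕ), 0 < A → 1 ≤ n → Real.log (A * Q ^ n) / (n * Real.log b)
      = Real.log A / (n * Real.log b) + Real.log Q / Real.log b := by
    intro A n hA hn
    have : (0 : ℝ) < n := by exact_mod_cast hn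
    rw [Real.log_mul hA.ne' (by positivity), Real.log_pow]
    field_simp
  refine tendsto_of_tendsto_of_tendsto_of_le_of_le' (hlim A₁) (hlim A₂) ?_ ?_
  · filter_upwards [h1, eventually_ge_atTop 1] with n hn1 hn
    have : (0 : ℝ) < n := by exact_mod_cast hn
    rw [← hexp A₁ n hA hn]
    gcongr
  · filter_upwards [h1, h2, eventually_ge_atTop 1] with n hn1 hn2 hn
    have : (0 : ℝ) < n := by exact_mod_cast hn
    have hpos : 0 < A₁ * Q ^ n := by positivity
    have hA2 : 0 < A₂ := by
      have : 0 < A₂ * Q ^ n := by linarith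
      exact pos_of_mul_pos_left this (by positivity)
    rw [← hexp A₂ n hA2 hn]
    have hf : (0 : ℝ) < f n := by linarith
    gcongr

theorem stmt12 (φ : ℝ → EuclideanSpace ℝ (Fin 2))
    (hper : ∀ x : ℝ, φ (x + 1) = φ x)
    (hLip : ∃ K : NNReal, LipschitzWith K φ)
    (hdisc : ¬ IsConnected ((Set.range φ)ᶜ)) :
    ∃ c : ℝ, 0 < c ∧ ∀ (b : ℕ), 2 ≤ b → ∀ lam : ℝ, 0 < lam → lam < 1 →
      (b : ℝ) * lam ^ 2 > c →
      ∀ W : ℝ → EuclideanSpace ℝ (Fin 2),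
        (∀ x : ℝ, W x = ∑' m : ℕ, lam ^ m • φ ((b : ℝ) ^ m * x)) →
        upperBoxDim b {p : Fin 3 → ℝ | ∃ x ∈ Set.Icc (0 : ℝ) 1, p = ![x, W x 0, W x 1]}
            = 3 + 2 * Real.logb b lam ∧
          lowerBoxDim b {p : Fin 3 → ℝ | ∃ x ∈ Set.Icc (0 : ℝ) 1, p = ![x, W x 0, W x 1]}
            = 3 + 2 * Real.logb b lam := by
  obtain ⟨K, hK⟩ := hLip
  have hφ : Continuous φ := hK.continuous
  have hLip' : ∀ x y, ‖φ x - φ y‖ ≤ (K : ℝ) * |x - y| := by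
    intro x y
    have := hK.dist_le_mul x y
    rwa [dist_eq_norm, Real.dist_eq] at this
  obtain ⟨c, hc2, hc⟩ := has_balls φ hper K.2 hLip' hφ hdisc
  refine ⟨c, by linarith, ?_⟩
  intro b hb lam hl0 hl1 hbl W hW
  obtain ⟨ρ, hρ, hballs⟩ := hc b lam hl0 hl1 hbl
  have hb0 : 0 < b := by omega
  have hq : 2 ≤ lam * b := by
    have h1 : lam * (lam * b) ≤ 1 * (lam * b) := by
      apply mul_le_mul_of_nonneg_right hl1.le; positivity
    nlinarith
  have hMex : ∃ M, ∀ x, ‖φ x‖ ≤ M := by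
    have hper' : Function.Periodic φ 1 := hper
    have hS := hper'.image_Icc one_pos 0
    have hcomp : IsCompact (range φ) := by rw [← hS]; exact isCompact_Icc.image hφ
    obtain ⟨M, hM⟩ := hcomp.isBounded.exists_norm_le
    exact ⟨M, fun x => hM _ (mem_range_self x)⟩
  obtain ⟨M, hM⟩ := hMex
  have hM0 : 0 ≤ M := (norm_nonneg _).trans (hM 0)
  set C : ℝ := K + 2 * (M / (1 - lam)) with hCdef
  have hM1 : 0 ≤ M / (1 - lam) := div_nonneg hM0 (by linarith)
  have hK0 : (0 : ℝ) ≤ K := K.2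
  have hC0 : 0 ≤ C := by rw [hCdef]; linarith
  have hosc : ∀ (N : ℕ) (x y : ℝ), |x - y| ≤ 1 / (b : ℝ) ^ N → ‖W x - W y‖ ≤ C * lam ^ N := by
    intro N x y hxy
    have t1 := W_tail (b := b) hM hl0 hl1 N x
    have t2 := W_tail (b := b) hM hl0 hl1 N y
    rw [← hW] at t1 t2
    have t3 : ‖SS φ lam b N x - SS φ lam b N y‖ ≤ K * lam ^ N := by
      refine (SS_lip hK0 hLip' hl0 hq N x y).trans ?_
      have h4 : 2 * (K : ℝ) / (lam * b) ≤ K := by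
        rw [div_le_iff₀ (by linarith)]; nlinarith
      calc 2 * (K : ℝ) / (lam * b) * (lam * b) ^ N * |x - y|
          ≤ K * (lam * b) ^ N * (1 / (b : ℝ) ^ N) := by gcongr
        _ = K * lam ^ N := by rw [mul_pow]; field_simp
    have t4 : W x - W y = (W x - SS φ lam b N x) - (W y - SS φ lam b N y)
        + (SS φ lam b N x - SS φ lam b N y) := by abel
    rw [t4, hCdef]
    have t5 := norm_add_le ((W x - SS φ lam b N x) - (W y - SS φ lam b N y))
      (SS φ lam b N x - SS φ lam b N y)
    have t6 := norm_sub_le (W x - SS φ lam b N x) (W y - SS φ lam b N y)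
    linarith
  have hup := count_upper hb0 hC0 hl0 (by linarith) hosc
  have hbig : ∀ᶠ N : ℕ in atTop, 8 ≤ ρ * (lam * b) ^ N := by
    have : Tendsto (fun N : ℕ => ρ * (lam * b) ^ N) atTop atTop :=
      (tendsto_pow_atTop_atTop_of_one_lt (by linarith)).const_mul_atTop hρ
    exact this.eventually_ge_atTop 8
  have hlim : Tendsto (fun n : ℕ => Real.log (boxCount b n (GG W)) / (n * Real.log b)) atTop
      (𝓝 (3 + 2 * Real.logb b lam)) := by
    refine limit_dim hb hl0 (fun n => boxCount b n (GG W)) (A₁ := ρ ^ 2 / 64)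
      (A₂ := 2 * (2 * C + 5) ^ 2) (by positivity) ?_ ?_
    · filter_upwards [hbig, eventually_ge_atTop 1] with N h8 h1
      refine count_lower hb hρ hl0 ?_ N h1 (hup N).1 h8
      intro N j
      obtain ⟨C', hC'⟩ := hballs N j
      refine ⟨C', fun y hy => ?_⟩
      obtain ⟨x, hx, hxy⟩ := hC' y hy
      exact ⟨x, hx, by rw [hW, hxy]⟩
    · exact Eventually.of_forall fun N => (hup N).2
  exact ⟨hlim.limsup_eq, hlim.liminf_eq⟩
end
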